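/- Let α ∈ ℝ, 0 < s < p < ∞, s < r < ∞ and s < q < ∞, with −n/r < α < n(1/s − 1/r). Let T be a map from measurable functions to measurable functions such that for every Λ ≥ 1 there is C(Λ) > 0 with ‖Tf‖_{L^s_w} ≤ C(Λ)‖f‖_{L^s_w} for every w ∈ A_1(ℝⁿ) with [w]_{A_1} ≤ Λ and every f ∈ L^s_w(ℝⁿ). Then there is C' > 0 such that ‖Tf‖_{K̇^{α,p}_{r,q}} ≤ C'‖f‖_{K̇^{α,p}_{r,q}} for every f ∈ K̇^{α,p}_{r,q}(ℝⁿ). -/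

import Mathlib

open MeasureTheory ENNReal Set Filter
open scoped NNReal Topology

noncomputable section

/-- Euclidean space `ℝⁿ`. -/
abbrev Euc (n : ℕ) := EuclideanSpace ℝ (Fin n)

/-- The dyadic annulus `C_k = B(0,2^k) \ B(0,2^{k-1})`. -/
def annulus (n : ℕ) (k : ℤ) : Set (Euc n) :=
  Metric.ball (0 : Euc n) ((2 : ℝ) ^ k) \ Metric.ball (0 : Euc n) ((2 : ℝ) ^ (k - 1))

/-- The Hardy–Littlewood maximal operator, acting on nonnegative extended-real-valued
functions (representing `|f|`): `Mf(x) = sup_{B ∋ x} |B|⁻¹ ∫_B f`. -/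
def maximalFn {n : ℕ} (f : Euc n → ℝ≥0∞) (x : Euc n) : ℝ≥0∞ :=
  ⨆ (c : Euc n) (r : ℝ) (_ : 0 < r) (_ : x ∈ Metric.ball c r),
    (volume (Metric.ball c r))⁻¹ * ∫⁻ y in Metric.ball c r, f y ∂volume

/-- A ball Banach function space on `ℝⁿ`, encoded by its norm functional `N`,
defined on all nonnegative extended-real-valued measurable functions (a real measurable
function `f` has norm `N (fun x => ‖f x‖₊)`). -/
structure BallBFS (n : ℕ) where
  N : (Euc n → ℝ≥0∞) → ℝ≥0∞
  norm_zero_iff : ∀ f : Euc n → ℝ≥0∞, Measurable f → (N f = 0 ↔ f =ᵐ[volume] 0)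
  norm_mono : ∀ f g : Euc n → ℝ≥0∞, (∀ᵐ x ∂volume, g x ≤ f x) → N g ≤ N f
  norm_isup : ∀ f : ℕ → Euc n → ℝ≥0∞, (∀ m, ∀ᵐ x ∂volume, f m x ≤ f (m + 1) x) →
    N (fun x => ⨆ m, f m x) = ⨆ m, N (f m)
  ball_mem : ∀ (x : Euc n) (r : ℝ), 0 < r → N ((Metric.ball x r).indicator 1) < ∞
  norm_add : ∀ f g : Euc n → ℝ≥0∞, N (fun x => f x + g x) ≤ N f + N g
  ball_integral : ∀ (x : Euc n) (r : ℝ), 0 < r → ∃ C : ℝ≥0∞, 0 < C ∧ C < ∞ ∧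
    ∀ f : Euc n → ℝ≥0∞, N f < ∞ → ∫⁻ y in Metric.ball x r, f y ∂volume ≤ C * N f

/-- The associate ("Köthe dual") norm of a norm functional `N`:
`‖g‖_{X'} = sup { ∫ f·g : ‖f‖_X ≤ 1 }`. -/
def assocN {n : ℕ} (N : (Euc n → ℝ≥0∞) → ℝ≥0∞) (g : Euc n → ℝ≥0∞) : ℝ≥0∞ :=
  ⨆ (f : Euc n → ℝ≥0∞) (_ : Measurable f) (_ : N f ≤ 1), ∫⁻ x, f x * g x ∂volume

/-- The homogeneous Herz-type quasinorm associated with a norm functional `N`,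
for a finite exponent `0 < p < ∞`:
`‖f‖ = (Σ_{k∈ℤ} 2^{kpα} ‖f χ_k‖_X ^ p)^{1/p}`. -/
def herzNorm {n : ℕ} (N : (Euc n → ℝ≥0∞) → ℝ≥0∞) (α p : ℝ) (f : Euc n → ℝ≥0∞) : ℝ≥0∞ :=
  (∑' k : ℤ, (2 : ℝ≥0∞) ^ ((k : ℝ) * p * α) * (N ((annulus n k).indicator f)) ^ p) ^ (1 / p)

/-- The homogeneous Herz-type quasinorm, with exponent `p ∈ (0,∞]`
(for `p = ∞` the sum is replaced by a supremum). -/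
def herzNormE {n : ℕ} (N : (Euc n → ℝ≥0∞) → ℝ≥0∞) (α : ℝ) (p : ℝ≥0∞)
    (f : Euc n → ℝ≥0∞) : ℝ≥0∞ :=
  if p = ∞ then ⨆ k : ℤ, (2 : ℝ≥0∞) ^ ((k : ℝ) * α) * N ((annulus n k).indicator f)
  else herzNorm N α p.toReal f

/-- The decreasing rearrangement `f*(t) = inf { s : |{x : |f(x)| > s}| ≤ t }` of a
nonnegative extended-real-valued function `f` (representing `|f|`). -/
def rearrangement {n : ℕ} (f : Euc n → ℝ≥0∞) (t : ℝ) : ℝ≥0∞ :=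
  ⨅ (s : ℝ≥0∞) (_ : volume {x : Euc n | s < f x} ≤ ENNReal.ofReal t), s

/-- The Lorentz quasinorm `‖f‖_{L^{r,q}} = (∫_0^∞ (t^{1/r} f*(t))^q dt/t)^{1/q}`. -/
def lorentzNorm {n : ℕ} (r q : ℝ) (f : Euc n → ℝ≥0∞) : ℝ≥0∞ :=
  (∫⁻ t in Set.Ioi (0 : ℝ),
      (ENNReal.ofReal (t ^ (1 / r)) * rearrangement f t) ^ q / ENNReal.ofReal t
    ∂volume) ^ (1 / q)

/-- The Herz quasinorm of a real-valued function (finite exponent `p`). -/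
def herzR {n : ℕ} (N : (Euc n → ℝ≥0∞) → ℝ≥0∞) (α p : ℝ) (f : Euc n → ℝ) : ℝ≥0∞ :=
  herzNorm N α p (fun x => (‖f x‖₊ : ℝ≥0∞))

/-- The weighted Lebesgue quasinorm `‖f‖_{L^s_w} = (∫ |f|^s w)^{1/s}`. -/
def wLpNorm {n : ℕ} (s : ℝ) (w : Euc n → ℝ≥0∞) (f : Euc n → ℝ) : ℝ≥0∞ :=
  (∫⁻ x, (‖f x‖₊ : ℝ≥0∞) ^ s * w x ∂volume) ^ (1 / s)

/-- The Muckenhoupt `A₁` condition with constant (at most) `Λ`. -/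
def IsA1 {n : ℕ} (Λ : ℝ≥0∞) (w : Euc n → ℝ≥0∞) : Prop :=
  Measurable w ∧ (∀ᵐ x ∂volume, 0 < w x ∧ w x < ∞) ∧
    (∀ (x : Euc n) (r : ℝ), 0 < r → ∫⁻ y in Metric.ball x r, w y ∂volume < ∞) ∧
    ∀ᵐ x ∂volume, maximalFn w x ≤ Λ * w x

theorem volume_euc_ball {n : ℕ} (c : Euc n) {ρ : ℝ} (hρ : 0 < ρ) :
    volume (Metric.ball c ρ) =
      ENNReal.ofReal (ρ ^ n) * volume (Metric.ball (0 : Euc n) 1) := by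
  simpa using Measure.addHaar_ball_of_pos (volume : Measure (Euc n)) c hρ

theorem volume_euc_ball_mul {n : ℕ} (c c' : Euc n) {a ρ : ℝ} (ha : 0 < a) (hρ : 0 < ρ) :
    volume (Metric.ball c (a * ρ)) = ENNReal.ofReal (a ^ n) * volume (Metric.ball c' ρ) := by
  rw [volume_euc_ball c (by positivity), volume_euc_ball c' hρ, mul_pow,
    ENNReal.ofReal_mul (by positivity), mul_assoc]

theorem volume_euc_ball_ne_zero {n : ℕ} (c : Euc n) {ρ : ℝ} (hρ : 0 < ρ) :
    volume (Metric.ball c ρ) ≠ 0 :=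
  (Metric.measure_ball_pos volume c hρ).ne'

theorem volume_euc_ball_ne_top {n : ℕ} (c : Euc n) (ρ : ℝ) :
    volume (Metric.ball c ρ) ≠ ∞ := measure_ball_lt_top.ne

theorem average_le_maximalFn {n : ℕ} (f : Euc n → ℝ≥0∞) {c x : Euc n} {ρ : ℝ} (hρ : 0 < ρ)
    (hx : x ∈ Metric.ball c ρ) :
    (volume (Metric.ball c ρ))⁻¹ * ∫⁻ y in Metric.ball c ρ, f y ∂volume ≤ maximalFn f x :=
  le_iSup₂_of_le c ρ (le_iSup₂_of_le hρ hx le_rfl)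

theorem maximalFn_le {n : ℕ} {f : Euc n → ℝ≥0∞} {x : Euc n} {b : ℝ≥0∞}
    (h : ∀ (c : Euc n) (ρ : ℝ), 0 < ρ → x ∈ Metric.ball c ρ →
      (volume (Metric.ball c ρ))⁻¹ * ∫⁻ y in Metric.ball c ρ, f y ∂volume ≤ b) :
    maximalFn f x ≤ b :=
  iSup₂_le fun c ρ => iSup₂_le fun hρ hx => h c ρ hρ hx

theorem lt_maximalFn_iff {n : ℕ} {f : Euc n → ℝ≥0∞} {x : Euc n} {l : ℝ≥0∞} :
    l < maximalFn f x ↔ ∃ (c : Euc n) (ρ : ℝ), 0 < ρ ∧ x ∈ Metric.ball c ρ ∧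
      l < (volume (Metric.ball c ρ))⁻¹ * ∫⁻ y in Metric.ball c ρ, f y ∂volume := by
  simp only [maximalFn, lt_iSup_iff, exists_prop]

theorem measurable_maximalFn {n : ℕ} (f : Euc n → ℝ≥0∞) : Measurable (maximalFn f) := by
  refine measurable_of_Ioi fun l => IsOpen.measurableSet ?_
  rw [isOpen_iff_mem_nhds]
  intro x hx
  obtain ⟨c, ρ, hρ, hxρ, h⟩ := lt_maximalFn_iff.1 hx
  filter_upwards [Metric.isOpen_ball.mem_nhds hxρ] with y hy
  exact lt_maximalFn_iff.2 ⟨c, ρ, hρ, hy, h⟩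

/-- The weak type `(1,1)` inequality for the Hardy–Littlewood maximal operator. -/
theorem mul_volume_lt_maximalFn_le {n : ℕ} (hn : 0 < n) (f : Euc n → ℝ≥0∞) {l : ℝ≥0∞}
    (hl0 : l ≠ 0) (hl : l ≠ ∞) :
    l * volume {x | l < maximalFn f x} ≤ ENNReal.ofReal (5 ^ n) * ∫⁻ x, f x ∂volume := by
  by_cases hf : ∫⁻ x, f x ∂volume = ∞
  · rw [hf, ENNReal.mul_top (by simp)]
    exact le_top
  let t : Set (Euc n × ℝ) := {b | 0 < b.2 ∧
    l < (volume (Metric.ball b.1 b.2))⁻¹ * ∫⁻ y in Metric.ball b.1 b.2, f y ∂volume}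
  have hball : ∀ b ∈ t, l * volume (Metric.ball b.1 b.2) ≤
      ∫⁻ y in Metric.ball b.1 b.2, f y ∂volume := by
    intro b hb
    have h := hb.2.le
    rw [mul_comm, ← div_eq_mul_inv] at h
    exact ENNReal.mul_le_of_le_div h
  set V : ℝ≥0∞ := (l * volume (Metric.ball (0 : Euc n) 1))⁻¹ * ∫⁻ x, f x ∂volume with hV
  have hκ0 := volume_euc_ball_ne_zero (0 : Euc n) one_pos
  have hκ := volume_euc_ball_ne_top (0 : Euc n) 1
  have hVtop : V ≠ ∞ := ENNReal.mul_ne_top (ENNReal.inv_ne_top.2 (mul_ne_zero hl0 hκ0)) hf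
  have hrad : ∀ b ∈ t, b.2 ≤ max 1 V.toReal := by
    intro b hb
    rcases le_total b.2 1 with h1 | h1
    · exact le_max_of_le_left h1
    refine le_max_of_le_right ?_
    have h2 : b.2 ≤ b.2 ^ n := le_self_pow₀ h1 hn.ne'
    refine h2.trans ((ENNReal.ofReal_le_iff_le_toReal hVtop).1 ?_)
    have h3 := (hball b hb).trans (setLIntegral_le_lintegral _ _)
    rw [volume_euc_ball _ hb.1] at h3
    rw [hV, mul_comm, ← div_eq_mul_inv,
      ENNReal.le_div_iff_mul_le (Or.inl (mul_ne_zero hl0 hκ0)) (Or.inl (ENNReal.mul_ne_top hl hκ))]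
    calc _ = l * (ENNReal.ofReal (b.2 ^ n) * volume (Metric.ball (0 : Euc n) 1)) := by ring
      _ ≤ _ := h3
  obtain ⟨u, hut, hdisj, hcov⟩ := Vitali.exists_disjoint_subfamily_covering_enlargement_closedBall
    t (fun b => b.1) (fun b => b.2) _ hrad 4 (by norm_num)
  have hucount : u.Countable := by
    refine hdisj.countable_of_nonempty_interior fun b hb => ?_
    exact ⟨b.1, interior_mono Metric.ball_subset_closedBall
      (by rw [Metric.isOpen_ball.interior_eq]; exact Metric.mem_ball_self (hut hb).1)⟩
  have hsub : {x | l < maximalFn f x} ⊆ ⋃ b ∈ u, Metric.ball b.1 (5 * b.2) := by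
    intro x hx
    obtain ⟨c, ρ, hρ, hxρ, h⟩ := lt_maximalFn_iff.1 hx
    obtain ⟨b, hb, hsubset⟩ := hcov (c, ρ) ⟨hρ, h⟩
    refine mem_biUnion hb (Metric.closedBall_subset_ball ?_
      (hsubset (Metric.ball_subset_closedBall hxρ)))
    have := (hut hb).1
    linarith
  calc l * volume {x | l < maximalFn f x}
      ≤ l * ∑' b : u, volume (Metric.ball b.1.1 (5 * b.1.2)) := by
        gcongr
        exact (measure_mono hsub).trans (measure_biUnion_le _ hucount _)
    _ = ENNReal.ofReal (5 ^ n) * ∑' b : u, l * volume (Metric.ball b.1.1 b.1.2) := by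
        rw [← ENNReal.tsum_mul_left, ← ENNReal.tsum_mul_left]
        refine tsum_congr fun b => ?_
        rw [volume_euc_ball_mul _ b.1.1 (by norm_num) (hut b.2).1]
        ring
    _ ≤ ENNReal.ofReal (5 ^ n) * ∑' b : u, ∫⁻ y in Metric.ball b.1.1 b.1.2, f y ∂volume := by
        gcongr with b
        exact hball b.1 (hut b.2)
    _ = ENNReal.ofReal (5 ^ n) * ∫⁻ y in ⋃ b ∈ u, Metric.ball b.1 b.2, f y ∂volume := by
        rw [lintegral_biUnion hucount (fun b _ => Metric.isOpen_ball.measurableSet)]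
        exact hdisj.mono fun b => Metric.ball_subset_closedBall
    _ ≤ _ := by gcongr; exact Measure.restrict_le_self

theorem setLIntegral_indicator_one {n : ℕ} {E : Set (Euc n)} (hE : MeasurableSet E)
    (B : Set (Euc n)) :
    ∫⁻ y in B, E.indicator (1 : Euc n → ℝ≥0∞) y ∂volume = volume (E ∩ B) := by
  rw [lintegral_indicator_one hE, Measure.restrict_apply hE]

theorem maximalFn_indicator_le_one {n : ℕ} (E : Set (Euc n)) (hE : MeasurableSet E) (x : Euc n) :
    maximalFn (E.indicator 1) x ≤ 1 := by
  refine maximalFn_le fun c ρ hρ hx => ?_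
  rw [setLIntegral_indicator_one hE, mul_comm, ← div_eq_mul_inv]
  exact ENNReal.div_le_of_le_mul (by rw [one_mul]; exact measure_mono inter_subset_right)

theorem maximalFn_indicator_pos {n : ℕ} {E : Set (Euc n)} (hE : MeasurableSet E)
    (h0 : volume E ≠ 0) (x : Euc n) : 0 < maximalFn (E.indicator 1) x := by
  have h1 : ∃ N : ℕ, volume (E ∩ Metric.ball x N) ≠ 0 := by
    by_contra! h
    refine h0 ?_
    rw [← inter_univ E, ← Metric.iUnion_ball_nat x, inter_iUnion]
    exact measure_iUnion_null h
  obtain ⟨N, hN⟩ := h1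
  have hNpos : (0 : ℝ) < N := by
    by_contra h
    exact hN (by rw [Metric.ball_eq_empty.2 (not_lt.1 h)]; simp)
  refine lt_of_lt_of_le ?_ (average_le_maximalFn _ hNpos (Metric.mem_ball_self hNpos))
  rw [setLIntegral_indicator_one hE]
  exact ENNReal.mul_pos (ENNReal.inv_ne_zero.2 (volume_euc_ball_ne_top _ _)) hN

theorem one_le_maximalFn_indicator_ae {n : ℕ} {E : Set (Euc n)} (hE : MeasurableSet E) :
    ∀ᵐ x ∂volume, x ∈ E → 1 ≤ maximalFn (E.indicator 1) x := by
  rw [← ae_restrict_iff' hE]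
  filter_upwards [Besicovitch.ae_tendsto_measure_inter_div (volume : Measure (Euc n)) E] with x hx
  refine le_of_tendsto hx ?_
  filter_upwards [self_mem_nhdsWithin] with ρ (hρ : 0 < ρ)
  refine le_trans ?_ (average_le_maximalFn _ hρ (Metric.mem_ball_self hρ))
  have hsph := Measure.addHaar_sphere_of_ne_zero (volume : Measure (Euc n)) x hρ.ne'
  have hle (A : Set (Euc n)) :
      volume (A ∩ Metric.closedBall x ρ) ≤ volume (A ∩ Metric.ball x ρ) := by
    rw [← Metric.ball_union_sphere, inter_union_distrib_left]
    refine (measure_union_le _ _).trans ?_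
    rw [measure_mono_null inter_subset_right hsph, add_zero]
  rw [setLIntegral_indicator_one hE, mul_comm, ← div_eq_mul_inv]
  exact ENNReal.div_le_div (hle E) (measure_mono Metric.ball_subset_closedBall)

theorem le_add_tsum_ite_lt {h : ℝ≥0∞} {d : ℕ → ℝ≥0∞} (hex : ∃ m, h ≤ d m) :
    h ≤ d 0 + ∑' m : ℕ, d (m + 1) * (if d m < h then 1 else 0) := by
  classical
  have h1 := Nat.find_spec hex
  rcases hm : Nat.find hex with _ | m
  · rw [hm] at h1
    exact h1.trans le_self_add
  · have h2 := Nat.find_min hex (m := m) (by omega)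
    rw [hm] at h1
    refine le_add_left (le_trans ?_ (ENNReal.le_tsum m))
    rwa [if_pos (not_le.1 h2), mul_one]

theorem rpow_le_add_tsum_dyadic {h a : ℝ≥0∞} {δ : ℝ} (hδ : 0 < δ) (hh : h ≠ ∞) (ha : a ≠ 0) :
    h ^ δ ≤ a ^ δ + ∑' m : ℕ, (2 ^ (m + 1) * a) ^ δ * (if 2 ^ m * a < h then 1 else 0) := by
  have hex : ∃ m : ℕ, h ^ δ ≤ (2 ^ m * a) ^ δ := by
    obtain ⟨m, hm⟩ := ENNReal.exists_nat_mul_gt ha hh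
    refine ⟨m, ENNReal.rpow_le_rpow (hm.le.trans ?_) hδ.le⟩
    gcongr
    exact_mod_cast Nat.lt_two_pow_self.le
  simpa only [pow_zero, one_mul, ENNReal.rpow_lt_rpow_iff hδ] using le_add_tsum_ite_lt hex

theorem rpow_le_tsum_dyadic {h : ℝ≥0∞} {δ : ℝ} (hδ : 0 ≤ δ) (h0 : h ≠ 0) (h1 : h ≤ 1) :
    h ^ δ ≤ ∑' m : ℕ, ((2⁻¹ : ℝ≥0∞) ^ m) ^ δ * (if 2⁻¹ ^ (m + 1) < h then 1 else 0) := by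
  classical
  have hex : ∃ m : ℕ, (2⁻¹ : ℝ≥0∞) ^ m < h := ENNReal.exists_inv_two_pow_lt h0
  have h2 := Nat.find_spec hex
  rcases hm : Nat.find hex with _ | m
  · rw [hm, pow_zero] at h2
    exact absurd h2 h1.not_gt
  · have h3 := Nat.find_min hex (m := m) (by omega)
    rw [hm] at h2
    refine le_trans ?_ (ENNReal.le_tsum m)
    rw [if_pos h2, mul_one]
    exact ENNReal.rpow_le_rpow (not_lt.1 h3) hδ

theorem lintegral_ite_lt {n : ℕ} {h : Euc n → ℝ≥0∞} (hh : Measurable h) (l c : ℝ≥0∞)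
    (B : Set (Euc n)) :
    ∫⁻ y in B, c * (if l < h y then 1 else 0) ∂volume = c * volume ({y | l < h y} ∩ B) := by
  have hm : MeasurableSet {y | l < h y} := measurableSet_lt measurable_const hh
  rw [← setLIntegral_indicator_one hm, ← lintegral_const_mul _ (measurable_one.indicator hm)]
  refine lintegral_congr fun y => ?_
  simp [indicator_apply]

/-- The constant in Kolmogorov's inequality for the maximal operator. -/
def kolmogorovConst (n : ℕ) (δ : ℝ) : ℝ≥0∞ :=
  1 + ENNReal.ofReal (5 ^ n) * ∑' m : ℕ, ((2 : ℝ≥0∞) ^ (m + 1)) ^ δ * (2 ^ m)⁻¹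

theorem two_rpow_lt_one {ε : ℝ} (hε : 0 < ε) : (2 : ℝ≥0∞) ^ (-ε) < 1 := by
  rw [ENNReal.rpow_neg]
  exact ENNReal.inv_lt_one.2 (ENNReal.one_lt_rpow (by norm_num) hε)

theorem tsum_two_rpow_neg_ne_top {ε : ℝ} (hε : 0 < ε) :
    ∑' m : ℕ, (2 : ℝ≥0∞) ^ (-(ε * m)) ≠ ∞ := by
  have : ∀ m : ℕ, (2 : ℝ≥0∞) ^ (-(ε * m)) = ((2 : ℝ≥0∞) ^ (-ε)) ^ m := fun m => by
    rw [← ENNReal.rpow_natCast, ← ENNReal.rpow_mul, neg_mul]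
  simp_rw [this]
  rw [ENNReal.tsum_geometric]
  exact ENNReal.inv_ne_top.2 (tsub_pos_of_lt (two_rpow_lt_one hε)).ne'

theorem kolmogorovConst_ne_top (n : ℕ) {δ : ℝ} (hδ : δ < 1) : kolmogorovConst n δ ≠ ∞ := by
  refine ENNReal.add_ne_top.2 ⟨one_ne_top, ENNReal.mul_ne_top ofReal_ne_top ?_⟩
  have : ∀ m : ℕ, ((2 : ℝ≥0∞) ^ (m + 1)) ^ δ * (2 ^ m)⁻¹ =
      2 ^ δ * (2 : ℝ≥0∞) ^ (-((1 - δ) * m)) := fun m => by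
    rw [← ENNReal.rpow_natCast, ← ENNReal.rpow_natCast, ← ENNReal.rpow_mul, ← ENNReal.rpow_neg,
      ← ENNReal.rpow_add _ _ two_ne_zero ofNat_ne_top,
      ← ENNReal.rpow_add _ _ two_ne_zero ofNat_ne_top]
    congr 1
    push_cast
    ring
  simp_rw [this]
  rw [ENNReal.tsum_mul_left]
  exact ENNReal.mul_ne_top (by simp [ENNReal.rpow_eq_top_iff])
    (tsum_two_rpow_neg_ne_top (by linarith))

/-- Kolmogorov's inequality for the maximal operator. -/
theorem setLIntegral_maximalFn_rpow_le {n : ℕ} (hn : 0 < n) {f : Euc n → ℝ≥0∞}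
    (hf : ∀ x, maximalFn f x ≠ ∞) {δ : ℝ} (hδ : 0 < δ) {a : ℝ≥0∞} (ha0 : a ≠ 0) (ha : a ≠ ∞)
    (B : Set (Euc n)) (hfa : ∫⁻ x, f x ∂volume ≤ a * volume B) :
    ∫⁻ y in B, maximalFn f y ^ δ ∂volume ≤ kolmogorovConst n δ * a ^ δ * volume B := by
  have hM := measurable_maximalFn f
  have hmeas : ∀ m : ℕ, Measurable fun y => (2 ^ (m + 1) * a) ^ δ *
      (if 2 ^ m * a < maximalFn f y then (1 : ℝ≥0∞) else 0) := fun m =>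
    (Measurable.ite (measurableSet_lt measurable_const hM) measurable_const
      measurable_const).const_mul _
  have hterm : ∀ m : ℕ, volume ({y | 2 ^ m * a < maximalFn f y} ∩ B) ≤
      ENNReal.ofReal (5 ^ n) * (2 ^ m)⁻¹ * volume B := by
    intro m
    have h2 : (2 : ℝ≥0∞) ^ m ≠ 0 := pow_ne_zero _ two_ne_zero
    have h2' : (2 : ℝ≥0∞) ^ m ≠ ∞ := ENNReal.pow_ne_top ofNat_ne_top
    have h := (mul_volume_lt_maximalFn_le hn f (mul_ne_zero h2 ha0)
      (ENNReal.mul_ne_top h2' ha)).trans (mul_le_mul_right hfa _)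
    refine (measure_mono inter_subset_left).trans ?_
    rw [← ENNReal.mul_le_mul_iff_right (mul_ne_zero h2 ha0) (ENNReal.mul_ne_top h2' ha)]
    refine h.trans_eq ?_
    calc _ = ENNReal.ofReal (5 ^ n) * (a * volume B) * 1 := by ring
      _ = ENNReal.ofReal (5 ^ n) * (a * volume B) * (2 ^ m * (2 ^ m)⁻¹) := by
        rw [ENNReal.mul_inv_cancel h2 h2']
      _ = _ := by ring
  calc ∫⁻ y in B, maximalFn f y ^ δ ∂volume
      ≤ ∫⁻ y in B, (a ^ δ + ∑' m : ℕ, (2 ^ (m + 1) * a) ^ δ *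
          (if 2 ^ m * a < maximalFn f y then 1 else 0)) ∂volume :=
        lintegral_mono fun y => rpow_le_add_tsum_dyadic hδ (hf y) ha0
    _ = a ^ δ * volume B + ∑' m : ℕ, (2 ^ (m + 1) * a) ^ δ *
          volume ({y | 2 ^ m * a < maximalFn f y} ∩ B) := by
        rw [lintegral_add_left measurable_const, setLIntegral_const,
          lintegral_tsum fun m => (hmeas m).aemeasurable]
        simp_rw [lintegral_ite_lt hM]
    _ ≤ a ^ δ * volume B + ∑' m : ℕ, (2 ^ (m + 1) * a) ^ δ *
          (ENNReal.ofReal (5 ^ n) * (2 ^ m)⁻¹ * volume B) := by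
        gcongr with m
        exact hterm m
    _ = _ := by
        have : ∀ m : ℕ, (2 ^ (m + 1) * a) ^ δ * (ENNReal.ofReal (5 ^ n) * (2 ^ m)⁻¹ * volume B) =
            (ENNReal.ofReal (5 ^ n) * a ^ δ * volume B) *
              (((2 : ℝ≥0∞) ^ (m + 1)) ^ δ * (2 ^ m)⁻¹) := fun m => by
          rw [ENNReal.mul_rpow_of_nonneg _ _ hδ.le]
          ring
        simp_rw [this]
        rw [ENNReal.tsum_mul_left, kolmogorovConst]
        ring

theorem setLIntegral_maximalFn_indicator_rpow_le {n : ℕ} (hn : 0 < n) {E : Set (Euc n)}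
    (hE : MeasurableSet E) {δ : ℝ} (hδ : 0 < δ) {B : Set (Euc n)} (hB0 : volume B ≠ 0)
    (hB : volume B ≠ ∞) (hEfin : volume E ≠ ∞) :
    ∫⁻ y in B, maximalFn (E.indicator 1) y ^ δ ∂volume ≤
      kolmogorovConst n δ * (volume E / volume B) ^ δ * volume B := by
  by_cases hE0 : volume E = 0
  · have hz : ∀ y, maximalFn (E.indicator 1) y = 0 := fun y => by
      refine le_antisymm (maximalFn_le fun c ρ _ _ => ?_) zero_le
      rw [setLIntegral_indicator_one hE, measure_mono_null inter_subset_left hE0, mul_zero]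
    simp [hz, hδ]
  · refine setLIntegral_maximalFn_rpow_le hn
      (fun x => ne_top_of_le_ne_top one_ne_top (maximalFn_indicator_le_one E hE x)) hδ
      (ENNReal.div_ne_zero.2 ⟨hE0, hB⟩) (ENNReal.div_ne_top hEfin hB0) B ?_
    rw [lintegral_indicator_one hE, ENNReal.div_mul_cancel hB0 hB]

theorem maximalFn_indicator_le_max {n : ℕ} {E : Set (Euc n)} (hE : MeasurableSet E)
    {c x y : Euc n} {ρ : ℝ} (hx : x ∈ Metric.ball c ρ) (hy : y ∈ Metric.ball c ρ) :
    maximalFn (E.indicator 1) y ≤ max (ENNReal.ofReal (3 ^ n) * maximalFn (E.indicator 1) x)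
      (maximalFn ((E ∩ Metric.ball c (3 * ρ)).indicator 1) y) := by
  refine maximalFn_le fun c' ρ' hρ' hy' => ?_
  rw [Metric.mem_ball] at hx hy hy'
  rcases le_total ρ ρ' with h | h
  · refine le_max_of_le_left ?_
    have hx3 : x ∈ Metric.ball c' (3 * ρ') := by
      rw [Metric.mem_ball]
      have h2 := dist_triangle x c c'
      have h3 := dist_triangle_left c c' y
      linarith
    have h4 := average_le_maximalFn (E.indicator 1) (by positivity : 0 < 3 * ρ') hx3
    have h30 : ENNReal.ofReal ((3 : ℝ) ^ n) ≠ 0 := (ENNReal.ofReal_pos.2 (by positivity)).ne'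
    calc _ ≤ ENNReal.ofReal (3 ^ n) * ((volume (Metric.ball c' (3 * ρ')))⁻¹ *
          ∫⁻ y in Metric.ball c' (3 * ρ'), E.indicator 1 y ∂volume) := by
          rw [volume_euc_ball_mul c' c' (by norm_num) hρ',
            ENNReal.mul_inv (Or.inl h30) (Or.inl ofReal_ne_top), ← mul_assoc, ← mul_assoc,
            ENNReal.mul_inv_cancel h30 ofReal_ne_top, one_mul]
          gcongr
          linarith
      _ ≤ _ := by gcongr
  · refine le_max_of_le_right (le_trans (le_of_eq ?_)
      (average_le_maximalFn _ hρ' (Metric.mem_ball.2 hy')))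
    rw [setLIntegral_indicator_one hE,
      setLIntegral_indicator_one (hE.inter Metric.isOpen_ball.measurableSet), inter_assoc]
    congr 3
    refine (inter_eq_self_of_subset_right (Metric.ball_subset_ball' ?_)).symm
    have h3 := dist_triangle_left c' c y
    linarith

/-- The Coifman–Rochberg theorem for indicator functions: `(Mχ_E)^δ` is an `A₁` weight with
constant depending only on `n` and `δ`. -/
theorem isA1_maximalFn_indicator_rpow {n : ℕ} (hn : 0 < n) {E : Set (Euc n)}
    (hE : MeasurableSet E) (hE0 : volume E ≠ 0) {δ : ℝ} (hδ : 0 < δ) :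
    IsA1 ((1 + kolmogorovConst n δ) * ENNReal.ofReal (3 ^ n) ^ δ)
      (fun x => maximalFn (E.indicator 1) x ^ δ) := by
  have hle1 := maximalFn_indicator_le_one E hE
  refine ⟨(measurable_maximalFn _).pow_const δ, ae_of_all _ fun x => ⟨?_, ?_⟩, fun x ρ _ => ?_,
    ae_of_all _ fun x => maximalFn_le fun c ρ hρ hx => ?_⟩
  · exact ENNReal.rpow_pos (maximalFn_indicator_pos hE hE0 x)
      (ne_top_of_le_ne_top one_ne_top (hle1 x))
  · exact (ENNReal.rpow_le_one (hle1 x) hδ.le).trans_lt one_lt_top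
  · calc _ ≤ ∫⁻ y in Metric.ball x ρ, 1 ∂volume :=
          lintegral_mono fun y => ENNReal.rpow_le_one (hle1 y) hδ.le
      _ < ∞ := by simpa using measure_ball_lt_top
  · set E' := E ∩ Metric.ball c (3 * ρ) with hE'
    have hE'm : MeasurableSet E' := hE.inter Metric.isOpen_ball.measurableSet
    have hE'fin : volume E' ≠ ∞ :=
      ne_top_of_le_ne_top (volume_euc_ball_ne_top c (3 * ρ)) (measure_mono inter_subset_right)
    have hB0 := volume_euc_ball_ne_zero c hρ
    have hB := volume_euc_ball_ne_top c ρ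
    set B := Metric.ball c ρ
    set K := kolmogorovConst n δ
    set t := ENNReal.ofReal (3 ^ n) * maximalFn (E.indicator 1) x
    have h30 : ENNReal.ofReal ((3 : ℝ) ^ n) ≠ 0 := (ENNReal.ofReal_pos.2 (by positivity)).ne'
    have ha : volume E' / volume B ≤ t := by
      have h := average_le_maximalFn (E.indicator 1) (by positivity : 0 < 3 * ρ)
        (Metric.ball_subset_ball (by linarith) hx)
      rw [volume_euc_ball_mul c c (by norm_num) hρ, setLIntegral_indicator_one hE,
        ENNReal.mul_inv (Or.inl h30) (Or.inl ofReal_ne_top)] at h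
      calc volume E' / volume B = ENNReal.ofReal (3 ^ n) * ((ENNReal.ofReal (3 ^ n))⁻¹ *
            (volume B)⁻¹ * volume E') := by
            rw [← mul_assoc, ← mul_assoc, ENNReal.mul_inv_cancel h30 ofReal_ne_top, one_mul,
              mul_comm, div_eq_mul_inv]
        _ ≤ t := mul_le_mul' le_rfl h
    have hpt : ∀ y ∈ B, maximalFn (E.indicator 1) y ^ δ ≤
        t ^ δ + maximalFn (E'.indicator 1) y ^ δ := fun y hy => by
      rcases le_max_iff.1 (maximalFn_indicator_le_max hE hx hy) with h | h
      · exact le_add_right (ENNReal.rpow_le_rpow h hδ.le)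
      · exact le_add_left (ENNReal.rpow_le_rpow h hδ.le)
    calc _ ≤ (volume B)⁻¹ * ∫⁻ y in B, (t ^ δ + maximalFn (E'.indicator 1) y ^ δ) ∂volume := by
          gcongr 1
          exact setLIntegral_mono' Metric.isOpen_ball.measurableSet hpt
      _ ≤ (volume B)⁻¹ * (t ^ δ * volume B + K * t ^ δ * volume B) := by
          gcongr 1
          rw [lintegral_add_left measurable_const, setLIntegral_const]
          gcongr 1
          refine (setLIntegral_maximalFn_indicator_rpow_le hn hE'm hδ hB0 hB hE'fin).trans ?_
          exact mul_le_mul' (mul_le_mul' le_rfl (ENNReal.rpow_le_rpow ha hδ.le)) le_rfl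
      _ = (volume B)⁻¹ * volume B * ((1 + K) * t ^ δ) := by ring
      _ = _ := by
          rw [ENNReal.inv_mul_cancel hB0 hB, one_mul, ENNReal.mul_rpow_of_nonneg _ _ hδ.le,
            mul_assoc]

/-- Minkowski's inequality for countable sums of nonnegative functions. -/
theorem lintegral_Lp_tsum_le {X ι : Type*} [MeasurableSpace X] [Countable ι] {μ : Measure X}
    {f : ι → X → ℝ≥0∞} (hf : ∀ i, AEMeasurable (f i) μ) {p : ℝ} (hp : 1 ≤ p) :
    (∫⁻ x, (∑' i, f i x) ^ p ∂μ) ^ (1 / p) ≤ ∑' i, (∫⁻ x, f i x ^ p ∂μ) ^ (1 / p) := by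
  classical
  have hp0 : 0 < p := zero_lt_one.trans_le hp
  have hfin : ∀ s : Finset ι, (∫⁻ x, (∑ i ∈ s, f i x) ^ p ∂μ) ^ (1 / p) ≤
      ∑ i ∈ s, (∫⁻ x, f i x ^ p ∂μ) ^ (1 / p) := by
    intro s
    induction s using Finset.induction_on with
    | empty => simp [hp0]
    | insert a s ha ih =>
      simp only [Finset.sum_insert ha]
      have h := ENNReal.lintegral_Lp_add_le (hf a)
        (Finset.aemeasurable_fun_sum s fun i _ => hf i) hp
      exact h.trans (add_le_add le_rfl ih)
  have hsup : ∀ x, (∑' i, f i x) ^ p = ⨆ s : Finset ι, (∑ i ∈ s, f i x) ^ p := fun x => by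
    rw [ENNReal.tsum_eq_iSup_sum]
    exact (ENNReal.orderIsoRpow p hp0).map_iSup _
  simp_rw [hsup]
  rw [lintegral_iSup_directed
    (fun s => (Finset.aemeasurable_fun_sum s fun i _ => hf i).pow_const p)
    (Monotone.directed_le fun s t hst x =>
      ENNReal.rpow_le_rpow (Finset.sum_le_sum_of_subset hst) hp0.le), one_div,
    ENNReal.rpow_inv_le_iff hp0]
  refine iSup_le fun s => ?_
  rw [← ENNReal.rpow_inv_le_iff hp0, ← one_div]
  exact (hfin s).trans (ENNReal.sum_le_tsum s)

/-- The norm of `L^q((0,∞), dt/t)` with weight `t^{1/r}`; the Lorentz quasinorm of a function is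
this norm of its decreasing rearrangement. -/
def halfLineNorm (r q : ℝ) (φ : ℝ → ℝ≥0∞) : ℝ≥0∞ :=
  (∫⁻ t in Ioi (0 : ℝ), (ENNReal.ofReal (t ^ (1 / r)) * φ t) ^ q / ENNReal.ofReal t
    ∂volume) ^ (1 / q)

theorem lorentzNorm_eq_halfLineNorm {n : ℕ} (r q : ℝ) (f : Euc n → ℝ≥0∞) :
    lorentzNorm r q f = halfLineNorm r q (rearrangement f) := rfl

theorem halfLineNorm_eq {r q : ℝ} (hq : 0 < q) (φ : ℝ → ℝ≥0∞) :
    halfLineNorm r q φ =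
      (∫⁻ t in Ioi (0 : ℝ), (ENNReal.ofReal (t ^ (1 / r - 1 / q)) * φ t) ^ q ∂volume) ^
        (1 / q) := by
  rw [halfLineNorm]
  congr 1
  refine setLIntegral_congr_fun measurableSet_Ioi fun t (ht : 0 < t) => ?_
  have h : ENNReal.ofReal (t ^ (1 / r - 1 / q)) ^ q =
      ENNReal.ofReal (t ^ (1 / r)) ^ q / ENNReal.ofReal t := by
    rw [ENNReal.ofReal_rpow_of_pos (by positivity), ENNReal.ofReal_rpow_of_pos (by positivity),
      ← ENNReal.ofReal_div_of_pos ht, ← Real.rpow_mul ht.le, ← Real.rpow_mul ht.le, sub_mul,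
      Real.rpow_sub ht, one_div_mul_cancel hq.ne', Real.rpow_one]
  rw [ENNReal.mul_rpow_of_nonneg _ _ hq.le, ENNReal.mul_rpow_of_nonneg _ _ hq.le, h]
  simp only [div_eq_mul_inv]
  ring

theorem halfLineNorm_mono {r q : ℝ} (hq : 0 < q) {φ ψ : ℝ → ℝ≥0∞} (h : ∀ t, 0 < t → φ t ≤ ψ t) :
    halfLineNorm r q φ ≤ halfLineNorm r q ψ := by
  refine ENNReal.rpow_le_rpow (setLIntegral_mono' measurableSet_Ioi fun t ht => ?_)
    (by positivity)
  gcongr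
  exact h t ht

theorem halfLineNorm_const_mul {r q : ℝ} (hq : 0 < q) {φ : ℝ → ℝ≥0∞} (hφ : Measurable φ)
    (c : ℝ≥0∞) : halfLineNorm r q (fun t => c * φ t) = c * halfLineNorm r q φ := by
  rw [halfLineNorm_eq hq, halfLineNorm_eq hq]
  have : ∀ t : ℝ, (ENNReal.ofReal (t ^ (1 / r - 1 / q)) * (c * φ t)) ^ q =
      c ^ q * (ENNReal.ofReal (t ^ (1 / r - 1 / q)) * φ t) ^ q := fun t => by
    rw [← ENNReal.mul_rpow_of_nonneg _ _ hq.le]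
    congr 1
    ring
  simp_rw [this]
  rw [lintegral_const_mul _ (by fun_prop), ENNReal.mul_rpow_of_nonneg _ _ (by positivity),
    ← ENNReal.rpow_mul, mul_one_div_cancel hq.ne', ENNReal.rpow_one]

theorem halfLineNorm_tsum_le {ι : Type*} [Countable ι] {r q : ℝ} (hq : 1 ≤ q)
    {φ : ι → ℝ → ℝ≥0∞} (hφ : ∀ i, Measurable (φ i)) :
    halfLineNorm r q (fun t => ∑' i, φ i t) ≤ ∑' i, halfLineNorm r q (φ i) := by
  simp_rw [halfLineNorm_eq (zero_lt_one.trans_le hq), ← ENNReal.tsum_mul_left]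
  exact lintegral_Lp_tsum_le (fun i => by fun_prop) hq

theorem halfLineNorm_comp_mul_left {r q : ℝ} (hq : 0 < q) (φ : ℝ → ℝ≥0∞) {c : ℝ} (hc : 0 < c) :
    halfLineNorm r q (fun t => φ (c * t)) =
      ENNReal.ofReal (c ^ (-(1 / r))) * halfLineNorm r q φ := by
  rw [halfLineNorm_eq hq, halfLineNorm_eq hq]
  set γ := 1 / r - 1 / q with hγ
  set ψ : ℝ → ℝ≥0∞ := (Ioi (0 : ℝ)).indicator fun t => (ENNReal.ofReal (t ^ γ) * φ t) ^ q with hψ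
  have hemb : MeasurableEmbedding (fun t : ℝ => c * t) :=
    (Homeomorph.mulLeft₀ c hc.ne').measurableEmbedding
  have h1 : ∫⁻ t in Ioi (0 : ℝ), (ENNReal.ofReal (t ^ γ) * φ t) ^ q ∂volume =
      ENNReal.ofReal c * ∫⁻ t, ψ (c * t) ∂volume := by
    rw [← lintegral_indicator measurableSet_Ioi, ← hemb.lintegral_map ψ]
    conv_lhs => rw [← Real.smul_map_volume_mul_left hc.ne', abs_of_pos hc]
    rw [lintegral_smul_measure, smul_eq_mul]
  have h2 : ∫⁻ t, ψ (c * t) ∂volume = ENNReal.ofReal (c ^ γ) ^ q *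
      ∫⁻ t in Ioi (0 : ℝ), (ENNReal.ofReal (t ^ γ) * φ (c * t)) ^ q ∂volume := by
    rw [← lintegral_const_mul' _ _ (ENNReal.rpow_ne_top_of_nonneg hq.le ofReal_ne_top),
      ← lintegral_indicator measurableSet_Ioi]
    refine lintegral_congr fun t => ?_
    rw [hψ]
    by_cases ht : 0 < t
    · rw [indicator_of_mem (show c * t ∈ Ioi (0 : ℝ) from mul_pos hc ht),
        indicator_of_mem (show t ∈ Ioi (0 : ℝ) from ht), Real.mul_rpow hc.le ht.le,
        ENNReal.ofReal_mul (by positivity), ← ENNReal.mul_rpow_of_nonneg _ _ hq.le, mul_assoc]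
    · rw [indicator_of_notMem
        (show c * t ∉ Ioi (0 : ℝ) from fun h => ht (pos_of_mul_pos_right h hc.le)),
        indicator_of_notMem (show t ∉ Ioi (0 : ℝ) from ht)]
  rw [h1, h2, ← mul_assoc, ENNReal.mul_rpow_of_nonneg _ _ (by positivity), ← mul_assoc]
  have h3 : ENNReal.ofReal (c ^ (-(1 / r))) *
      (ENNReal.ofReal c * ENNReal.ofReal (c ^ γ) ^ q) ^ (1 / q) = 1 := by
    rw [ENNReal.ofReal_rpow_of_pos (by positivity), ← ENNReal.ofReal_mul hc.le,
      ENNReal.ofReal_rpow_of_pos (by positivity), ← ENNReal.ofReal_mul (by positivity),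
      Real.mul_rpow hc.le (by positivity), ← Real.rpow_mul hc.le, ← Real.rpow_mul hc.le,
      ← Real.rpow_add hc, ← Real.rpow_add hc, hγ]
    have : -(1 / r) + (1 / q + (1 / r - 1 / q) * q * (1 / q)) = 0 := by
      field_simp
      ring
    rw [this, Real.rpow_zero, ENNReal.ofReal_one]
  rw [h3, one_mul]

theorem antitone_rearrangement {n : ℕ} (f : Euc n → ℝ≥0∞) : Antitone (rearrangement f) := by
  intro a b hab
  refine le_iInf₂ fun l hl => ?_
  exact iInf₂_le (f := fun l _ => l) l (hl.trans (ENNReal.ofReal_le_ofReal hab))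

theorem measurable_rearrangement {n : ℕ} (f : Euc n → ℝ≥0∞) : Measurable (rearrangement f) :=
  (antitone_rearrangement f).measurable

theorem lt_volume_of_lt_rearrangement {n : ℕ} {f : Euc n → ℝ≥0∞} {t : ℝ} {l : ℝ≥0∞}
    (h : l < rearrangement f t) : ENNReal.ofReal t < volume {x | l < f x} := by
  by_contra! h'
  exact h.not_ge (iInf₂_le l h')

theorem volume_rearrangement_lt_le {n : ℕ} (f : Euc n → ℝ≥0∞) (t : ℝ) :
    volume {x | rearrangement f t < f x} ≤ ENNReal.ofReal t := by
  have hlt : ∀ l, rearrangement f t < l → volume {x | l < f x} ≤ ENNReal.ofReal t := by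
    intro l hl
    simp only [rearrangement, iInf_lt_iff, exists_prop] at hl
    obtain ⟨s, hs, hsl⟩ := hl
    exact (measure_mono fun x (hx : l < f x) => hsl.trans hx).trans hs
  by_cases htop : rearrangement f t = ∞
  · simp [htop]
  obtain ⟨u, hu, hua, hut⟩ := exists_seq_strictAnti_tendsto' (lt_top_iff_ne_top.2 htop)
  have hun : {x | rearrangement f t < f x} = ⋃ m, {x | u m < f x} := by
    ext x
    simp only [mem_ofPred_eq, mem_iUnion]
    refine ⟨fun hx => ?_, fun ⟨m, hm⟩ => (hua m).1.trans hm⟩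
    exact (hut.eventually_lt_const hx).exists
  have hmono : Monotone fun m => {x | u m < f x} :=
    fun a b hab x (hx : u a < f x) => (hu.antitone hab).trans_lt hx
  rw [hun, hmono.measure_iUnion]
  exact iSup_le fun m => hlt _ (hua m).1

/-- A dyadic form of `∫_A f ≤ ∫_0^{|A|} f*`. -/
theorem setLIntegral_le_tsum_rearrangement {n : ℕ} {f : Euc n → ℝ≥0∞} (hf : Measurable f)
    {A : Set (Euc n)} {v : ℝ} (hA : volume A ≤ ENNReal.ofReal v) :
    ∫⁻ x in A, f x ∂volume ≤
      ∑' i : ℕ, 2 * (ENNReal.ofReal (v / 2 ^ i) * rearrangement f (v / 2 ^ i)) := by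
  set d : ℕ → ℝ≥0∞ := fun i => rearrangement f (v / 2 ^ i) with hd
  have hv : ∀ i, volume {x | d i < f x} ≤ ENNReal.ofReal (v / 2 ^ i) := fun i =>
    volume_rearrangement_lt_le f _
  have hae : ∀ᵐ x ∂volume, ∃ i, f x ≤ d i := by
    simp only [ae_iff, not_exists, not_le]
    refine le_antisymm (ge_of_tendsto' (x := atTop)
      (f := fun i : ℕ => ENNReal.ofReal (v / 2 ^ i)) ?_
      fun i => (measure_mono fun x (hx : ∀ i, d i < f x) => hx i).trans (hv i)) zero_le
    rw [← ENNReal.ofReal_zero]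
    refine (ENNReal.continuous_ofReal.tendsto 0).comp ?_
    exact tendsto_const_nhds.div_atTop (tendsto_pow_atTop_atTop_of_one_lt one_lt_two)
  have hmeas : ∀ m : ℕ, Measurable fun y => d (m + 1) *
      (if d m < f y then (1 : ℝ≥0∞) else 0) := fun m =>
    (Measurable.ite (measurableSet_lt measurable_const hf) measurable_const
      measurable_const).const_mul _
  calc ∫⁻ x in A, f x ∂volume
      ≤ ∫⁻ x in A, (d 0 + ∑' m : ℕ, d (m + 1) * (if d m < f x then 1 else 0)) ∂volume := by
        refine lintegral_mono_ae (ae_restrict_of_ae ?_)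
        filter_upwards [hae] with x hx using le_add_tsum_ite_lt hx
    _ = d 0 * volume A + ∑' m : ℕ, d (m + 1) * volume ({x | d m < f x} ∩ A) := by
        rw [lintegral_add_left measurable_const, setLIntegral_const,
          lintegral_tsum fun m => (hmeas m).aemeasurable]
        simp_rw [lintegral_ite_lt hf]
    _ ≤ 2 * (ENNReal.ofReal (v / 2 ^ 0) * d 0) + ∑' m : ℕ,
          2 * (ENNReal.ofReal (v / 2 ^ (m + 1)) * d (m + 1)) := by
        refine add_le_add ?_ (ENNReal.tsum_le_tsum fun m => ?_)
        · rw [pow_zero, div_one, mul_comm (d 0)]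
          exact (mul_le_mul' hA le_rfl).trans (le_mul_of_one_le_left' one_le_two)
        · have h2 : ENNReal.ofReal (v / 2 ^ m) = 2 * ENNReal.ofReal (v / 2 ^ (m + 1)) := by
            rw [← ENNReal.ofReal_ofNat 2, ← ENNReal.ofReal_mul (by norm_num)]
            congr 1
            rw [pow_succ]
            field_simp
          rw [← mul_assoc, ← h2, mul_comm (d (m + 1))]
          exact mul_le_mul' ((measure_mono inter_subset_left).trans (hv m)) le_rfl
    _ = _ := (tsum_eq_zero_add' (f := fun i => 2 * (ENNReal.ofReal (v / 2 ^ i) * d i))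
        ENNReal.summable).symm

/-- The norm of `t^β` on `(0,1)`. -/
def powNorm (r q β : ℝ) : ℝ≥0∞ :=
  halfLineNorm r q ((Iio 1).indicator fun t => ENNReal.ofReal (t ^ β))

theorem measurable_pow_indicator (β b : ℝ) :
    Measurable ((Iio b).indicator fun t : ℝ => ENNReal.ofReal (t ^ β)) :=
  Measurable.indicator (by fun_prop) measurableSet_Iio

theorem powNorm_ne_top {r q β : ℝ} (hq : 0 < q) (hβ : 0 < β + 1 / r) : powNorm r q β ≠ ∞ := by
  rw [powNorm, halfLineNorm_eq hq]
  refine ENNReal.rpow_ne_top_of_nonneg (by positivity) ?_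
  have h : ∫⁻ t in Ioi (0 : ℝ), (ENNReal.ofReal (t ^ (1 / r - 1 / q)) *
      (Iio 1).indicator (fun t => ENNReal.ofReal (t ^ β)) t) ^ q ∂volume =
      ∫⁻ t in Ioo (0 : ℝ) 1, ENNReal.ofReal (t ^ ((β + 1 / r) * q - 1)) ∂volume := by
    rw [← lintegral_indicator measurableSet_Ioi, ← lintegral_indicator measurableSet_Ioo]
    refine lintegral_congr fun t => ?_
    by_cases h0 : 0 < t
    · by_cases h1 : t < 1
      · rw [indicator_of_mem (show t ∈ Ioi (0 : ℝ) from h0),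
          indicator_of_mem (show t ∈ Iio (1 : ℝ) from h1),
          indicator_of_mem (show t ∈ Ioo (0 : ℝ) 1 from ⟨h0, h1⟩),
          ← ENNReal.ofReal_mul (by positivity), ← Real.rpow_add h0,
          ENNReal.ofReal_rpow_of_pos (by positivity), ← Real.rpow_mul h0.le]
        congr 2
        field_simp
        ring
      · rw [indicator_of_mem (show t ∈ Ioi (0 : ℝ) from h0),
          indicator_of_notMem (show t ∉ Iio (1 : ℝ) from h1),
          indicator_of_notMem (show t ∉ Ioo (0 : ℝ) 1 from fun h => h1 h.2), mul_zero,
          ENNReal.zero_rpow_of_pos hq]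
    · rw [indicator_of_notMem (show t ∉ Ioi (0 : ℝ) from h0),
        indicator_of_notMem (show t ∉ Ioo (0 : ℝ) 1 from fun h => h0 h.1)]
  rw [h]
  have hint := (intervalIntegral.integrableOn_Ioo_rpow_iff (s := (β + 1 / r) * q - 1)
    (zero_lt_one' ℝ)).2 (by nlinarith)
  exact hint.setLIntegral_lt_top.ne

theorem powNorm_zero_ne_zero {r q : ℝ} (hq : 0 < q) : powNorm r q 0 ≠ 0 := by
  rw [powNorm, halfLineNorm_eq hq]
  refine (ENNReal.rpow_pos_of_nonneg ?_ (by positivity)).ne'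
  rw [setLIntegral_pos_iff (by
    have := measurable_pow_indicator 0 1
    fun_prop)]
  refine lt_of_lt_of_le (b := volume (Ioo (0 : ℝ) 1)) (by simp)
    (measure_mono fun t ht => ⟨?_, ht.1⟩)
  rw [Function.mem_support, indicator_of_mem (show t ∈ Iio (1 : ℝ) from ht.2)]
  have := ht.1
  refine (ENNReal.rpow_pos_of_nonneg ?_ hq.le).ne'
  exact ENNReal.mul_pos (ENNReal.ofReal_pos.2 (by positivity)).ne' (by simp)

theorem halfLineNorm_pow_indicator {r q : ℝ} (hq : 0 < q) (β : ℝ) {b : ℝ} (hb : 0 < b) :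
    halfLineNorm r q ((Iio b).indicator fun t => ENNReal.ofReal (t ^ β)) =
      ENNReal.ofReal (b ^ (β + 1 / r)) * powNorm r q β := by
  have h := halfLineNorm_comp_mul_left (r := r) hq
    ((Iio b).indicator fun t => ENNReal.ofReal (t ^ β)) hb
  have h2 : halfLineNorm r q
      (fun t => (Iio b).indicator (fun t => ENNReal.ofReal (t ^ β)) (b * t)) =
      ENNReal.ofReal (b ^ β) * powNorm r q β := by
    rw [powNorm, ← halfLineNorm_const_mul hq (measurable_pow_indicator β 1)]
    refine le_antisymm (halfLineNorm_mono hq fun t ht => le_of_eq ?_)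
      (halfLineNorm_mono hq fun t ht => le_of_eq ?_)
    all_goals
      by_cases h1 : t < 1
      · simp [h1, hb, Real.mul_rpow hb.le ht.le,
          ENNReal.ofReal_mul (show 0 ≤ b ^ β by positivity)]
      · simp [h1, hb]
  rw [h2] at h
  rw [Real.rpow_add hb, ENNReal.ofReal_mul (by positivity), mul_assoc,
    mul_comm (ENNReal.ofReal _) (_ * _),
    mul_assoc, mul_comm (powNorm r q β), h, ← mul_assoc, ← ENNReal.ofReal_mul (by positivity),
    ← Real.rpow_add hb]
  simp

theorem rearrangement_le_lorentzNorm {n : ℕ} {r q : ℝ} (hr : 0 < r) (hq : 0 < q)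
    (f : Euc n → ℝ≥0∞) {t : ℝ} (ht : 0 < t) :
    rearrangement f t ≤
      (powNorm r q 0)⁻¹ * (ENNReal.ofReal (t ^ (-(1 / r))) * lorentzNorm r q f) := by
  rw [lorentzNorm_eq_halfLineNorm, ← halfLineNorm_comp_mul_left hq _ ht,
    mul_comm (powNorm r q 0)⁻¹, ← div_eq_mul_inv,
    ENNReal.le_div_iff_mul_le (Or.inl (powNorm_zero_ne_zero hq))
      (Or.inl (powNorm_ne_top hq (by positivity))), powNorm,
    ← halfLineNorm_const_mul hq (measurable_pow_indicator 0 1)]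
  refine halfLineNorm_mono hq fun τ hτ => ?_
  by_cases h1 : τ < 1
  · simp only [indicator_apply, mem_Iio, h1, if_true, Real.rpow_zero, ENNReal.ofReal_one, mul_one]
    exact antitone_rearrangement f (by nlinarith)
  · simp [h1]

theorem ofReal_two_rpow (x : ℝ) : ENNReal.ofReal ((2 : ℝ) ^ x) = (2 : ℝ≥0∞) ^ x := by
  rw [← ENNReal.ofReal_rpow_of_pos two_pos, ENNReal.ofReal_ofNat]

theorem two_rpow_add (x y : ℝ) : (2 : ℝ≥0∞) ^ (x + y) = 2 ^ x * 2 ^ y :=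
  ENNReal.rpow_add _ _ two_ne_zero ofNat_ne_top

theorem two_rpow_ne_top (x : ℝ) : (2 : ℝ≥0∞) ^ x ≠ ∞ := by
  rw [← ofReal_two_rpow]; exact ofReal_ne_top

theorem ofReal_div_two_pow_rpow {v : ℝ} (hv : 0 ≤ v) (β : ℝ) (i : ℕ) :
    ENNReal.ofReal ((v / 2 ^ i) ^ β) = ENNReal.ofReal (v ^ β) * 2 ^ (-(β * i)) := by
  rw [← ofReal_two_rpow, ← ENNReal.ofReal_mul (by positivity), Real.div_rpow hv (by positivity),
    ← Real.rpow_natCast, ← Real.rpow_mul two_pos.le, Real.rpow_neg two_pos.le, mul_comm (i : ℝ),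
    div_eq_mul_inv]

/-- A dilation factor in the majorant of the rearrangement on neighbouring annuli. -/
def nearScale (n m i : ℕ) : ℝ := 5 ^ n * 2 ^ (m + 1) / 2 ^ i

theorem nearScale_pos (n m i : ℕ) : 0 < nearScale n m i := by
  unfold nearScale; positivity

/-- A majorant of `|E|⁻¹ ∫ f (Mχ_E)^δ`, as a function of `t ≤ |E|`. -/
def nearFn (n : ℕ) (δ : ℝ) (f : Euc n → ℝ≥0∞) (t : ℝ) : ℝ≥0∞ :=
  ∑' m : ℕ, ∑' i : ℕ, (((2⁻¹ : ℝ≥0∞) ^ m) ^ δ * (2 * ENNReal.ofReal (nearScale n m i))) *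
    rearrangement f (nearScale n m i * t)

/-- The bound for the norm of `nearFn`. -/
def nearConst (n : ℕ) (R δ : ℝ) : ℝ≥0∞ :=
  ∑' m : ℕ, ∑' i : ℕ, ((2⁻¹ : ℝ≥0∞) ^ m) ^ δ *
    (2 * ENNReal.ofReal (nearScale n m i ^ (1 - 1 / R)))

theorem nearConst_ne_top (n : ℕ) {R δ : ℝ} (hR : 0 < 1 - 1 / R) (hδ : 1 - 1 / R < δ) :
    nearConst n R δ ≠ ∞ := by
  set β := 1 - 1 / R with hβ
  have h : ∀ m i : ℕ, ((2⁻¹ : ℝ≥0∞) ^ m) ^ δ * (2 * ENNReal.ofReal (nearScale n m i ^ β)) =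
      2 * ENNReal.ofReal ((5 ^ n * 2) ^ β) * (2 : ℝ≥0∞) ^ (-((δ - β) * m)) *
        2 ^ (-(β * i)) := fun m i => by
    have h1 : ENNReal.ofReal ((5 ^ n * 2 ^ (m + 1)) ^ β) =
        ENNReal.ofReal ((5 ^ n * 2) ^ β) * 2 ^ (β * m) := by
      rw [← ofReal_two_rpow, ← ENNReal.ofReal_mul (by positivity), pow_succ', ← mul_assoc,
        Real.mul_rpow (by positivity) (by positivity), ← Real.rpow_natCast 2 m,
        ← Real.rpow_mul two_pos.le, mul_comm β]
    have h2 : ((2⁻¹ : ℝ≥0∞) ^ m) ^ δ = 2 ^ (-(δ * m)) := by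
      rw [← ENNReal.rpow_natCast, ← ENNReal.rpow_neg_one, ← ENNReal.rpow_mul, ← ENNReal.rpow_mul]
      congr 1
      ring
    have h3 : -((δ - β) * m) = -(δ * m) + β * m := by ring
    rw [nearScale, ofReal_div_two_pow_rpow (by positivity), h1, h2, h3, two_rpow_add]
    ring
  simp_rw [nearConst, ← hβ, h, ENNReal.tsum_mul_left]
  rw [ENNReal.tsum_mul_right, ENNReal.tsum_mul_left]
  exact ENNReal.mul_ne_top (ENNReal.mul_ne_top (ENNReal.mul_ne_top ofNat_ne_top ofReal_ne_top)
    (tsum_two_rpow_neg_ne_top (by linarith))) (tsum_two_rpow_neg_ne_top hR)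

theorem measurable_nearFn {n : ℕ} (δ : ℝ) (f : Euc n → ℝ≥0∞) : Measurable (nearFn n δ f) := by
  refine Measurable.tsum fun m => Measurable.tsum fun i => ?_
  exact ((measurable_rearrangement f).comp (measurable_const_mul _)).const_mul _

theorem halfLineNorm_nearFn_le {n : ℕ} {R Q : ℝ} (hQ : 1 ≤ Q) (δ : ℝ) (f : Euc n → ℝ≥0∞) :
    halfLineNorm R Q (nearFn n δ f) ≤ nearConst n R δ * lorentzNorm R Q f := by
  have hQ0 : 0 < Q := by linarith
  have hm : ∀ m i : ℕ, Measurable fun t => rearrangement f (nearScale n m i * t) := fun m i =>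
    (measurable_rearrangement f).comp (measurable_const_mul _)
  refine (halfLineNorm_tsum_le hQ fun m => Measurable.tsum fun i =>
    (hm m i).const_mul _).trans ?_
  rw [nearConst, ← ENNReal.tsum_mul_right]
  refine ENNReal.tsum_le_tsum fun m => ?_
  refine (halfLineNorm_tsum_le hQ fun i => (hm m i).const_mul _).trans ?_
  rw [← ENNReal.tsum_mul_right]
  refine ENNReal.tsum_le_tsum fun i => le_of_eq ?_
  have hc := nearScale_pos n m i
  rw [halfLineNorm_const_mul hQ0 (hm m i), halfLineNorm_comp_mul_left hQ0 _ hc,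
    lorentzNorm_eq_halfLineNorm, sub_eq_add_neg, Real.rpow_add hc, Real.rpow_one,
    ENNReal.ofReal_mul hc.le]
  ring

theorem lintegral_mul_maximalFn_rpow_le_nearFn {n : ℕ} (hn : 0 < n) {f : Euc n → ℝ≥0∞}
    (hf : Measurable f) {E : Set (Euc n)} (hE : MeasurableSet E) (hE0 : volume E ≠ 0)
    (hEfin : volume E ≠ ∞) {δ : ℝ} (hδ : 0 ≤ δ) {t : ℝ} (htE : ENNReal.ofReal t ≤ volume E) :
    ∫⁻ x, f x * maximalFn (E.indicator 1) x ^ δ ∂volume ≤ volume E * nearFn n δ f t := by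
  set h := maximalFn (E.indicator 1) with hh
  have hm : Measurable h := measurable_maximalFn _
  set u := (volume E).toReal with hu
  have hu' : volume E = ENNReal.ofReal u := (ENNReal.ofReal_toReal hEfin).symm
  have htu : t ≤ u := (ENNReal.ofReal_le_iff_le_toReal hEfin).1 htE
  have hmeas : ∀ m : ℕ, Measurable fun x => ((2⁻¹ : ℝ≥0∞) ^ m) ^ δ *
      ((if 2⁻¹ ^ (m + 1) < h x then 1 else 0) * f x) := fun m =>
    ((Measurable.ite (measurableSet_lt measurable_const hm) measurable_const
      measurable_const).mul hf).const_mul _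
  have hset : ∀ m : ℕ, volume {x | (2⁻¹ : ℝ≥0∞) ^ (m + 1) < h x} ≤
      ENNReal.ofReal (5 ^ n * 2 ^ (m + 1) * u) := by
    intro m
    have h2 : (2⁻¹ : ℝ≥0∞) ^ (m + 1) ≠ 0 := pow_ne_zero _ (by simp)
    have h2' : (2⁻¹ : ℝ≥0∞) ^ (m + 1) ≠ ∞ := ENNReal.pow_ne_top (by simp)
    have h3 := mul_volume_lt_maximalFn_le hn (E.indicator 1) h2 h2'
    rw [lintegral_indicator_one hE] at h3
    rw [← ENNReal.mul_le_mul_iff_right h2 h2']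
    refine h3.trans_eq ?_
    have h4 : ENNReal.ofReal (2 ^ (m + 1)) = 2 ^ (m + 1) := by
      rw [ENNReal.ofReal_pow two_pos.le, ENNReal.ofReal_ofNat]
    rw [ENNReal.ofReal_mul (by positivity), ENNReal.ofReal_mul (by positivity), ← hu', h4]
    calc _ = (2⁻¹ * 2) ^ (m + 1) * (ENNReal.ofReal (5 ^ n) * volume E) := by
          rw [ENNReal.inv_mul_cancel two_ne_zero ofNat_ne_top, one_pow, one_mul]
      _ = _ := by rw [mul_pow]; ring
  calc ∫⁻ x, f x * h x ^ δ ∂volume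
      ≤ ∫⁻ x, ∑' m : ℕ, ((2⁻¹ : ℝ≥0∞) ^ m) ^ δ *
          ((if 2⁻¹ ^ (m + 1) < h x then 1 else 0) * f x) ∂volume := by
        refine lintegral_mono fun x => ?_
        refine (mul_le_mul' le_rfl (rpow_le_tsum_dyadic hδ
          (maximalFn_indicator_pos hE hE0 x).ne' (maximalFn_indicator_le_one E hE x))).trans_eq ?_
        rw [← ENNReal.tsum_mul_left]
        exact tsum_congr fun m => by ring
    _ = ∑' m : ℕ, ((2⁻¹ : ℝ≥0∞) ^ m) ^ δ *
          ∫⁻ x in {x | (2⁻¹ : ℝ≥0∞) ^ (m + 1) < h x}, f x ∂volume := by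
        rw [lintegral_tsum fun m => (hmeas m).aemeasurable]
        refine tsum_congr fun m => ?_
        rw [lintegral_const_mul' _ _ (ENNReal.rpow_ne_top_of_nonneg hδ
            (ENNReal.pow_ne_top (by simp))),
          ← lintegral_indicator (measurableSet_lt measurable_const hm)]
        congr 1
        refine lintegral_congr fun x => ?_
        simp [indicator_apply]
    _ ≤ ∑' m : ℕ, ((2⁻¹ : ℝ≥0∞) ^ m) ^ δ *
          ∑' i : ℕ, 2 * (ENNReal.ofReal (5 ^ n * 2 ^ (m + 1) * u / 2 ^ i) *
            rearrangement f (5 ^ n * 2 ^ (m + 1) * u / 2 ^ i)) := by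
        gcongr with m
        exact setLIntegral_le_tsum_rearrangement hf (hset m)
    _ ≤ _ := by
        simp_rw [nearFn, ← ENNReal.tsum_mul_left]
        refine ENNReal.tsum_le_tsum fun m => ENNReal.tsum_le_tsum fun i => ?_
        have hs : 5 ^ n * 2 ^ (m + 1) * u / 2 ^ i = nearScale n m i * u := by
          rw [nearScale]; ring
        have hc := nearScale_pos n m i
        rw [hs, ENNReal.ofReal_mul hc.le, ← hu']
        calc _ = volume E * ((((2⁻¹ : ℝ≥0∞) ^ m) ^ δ * (2 * ENNReal.ofReal (nearScale n m i))) *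
              rearrangement f (nearScale n m i * u)) := by ring
          _ ≤ _ := by
            gcongr
            exact antitone_rearrangement f (by gcongr)

/-- The volume of the ball of radius `2^k` in `ℝⁿ`. -/
def dyadicVol (n : ℕ) (k : ℤ) : ℝ :=
  (volume (Metric.ball (0 : Euc n) 1)).toReal * 2 ^ ((k : ℝ) * n)

theorem toReal_volume_ball_pos (n : ℕ) : 0 < (volume (Metric.ball (0 : Euc n) 1)).toReal :=
  ENNReal.toReal_pos (volume_euc_ball_ne_zero 0 one_pos) (volume_euc_ball_ne_top 0 1)

theorem dyadicVol_pos (n : ℕ) (k : ℤ) : 0 < dyadicVol n k :=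
  mul_pos (toReal_volume_ball_pos n) (by positivity)

theorem volume_dyadic_ball (n : ℕ) (c : Euc n) (k : ℤ) :
    volume (Metric.ball c ((2 : ℝ) ^ k)) = ENNReal.ofReal (dyadicVol n k) := by
  rw [volume_euc_ball c (by positivity), dyadicVol, mul_comm,
    ENNReal.ofReal_mul ENNReal.toReal_nonneg, ENNReal.ofReal_toReal (volume_euc_ball_ne_top 0 1),
    Real.rpow_mul two_pos.le, Real.rpow_natCast, Real.rpow_intCast]

theorem dyadicVol_rpow (n : ℕ) (k : ℤ) (a : ℝ) :
    dyadicVol n k ^ a =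
      (volume (Metric.ball (0 : Euc n) 1)).toReal ^ a * 2 ^ ((k : ℝ) * n * a) := by
  rw [dyadicVol, Real.mul_rpow ENNReal.toReal_nonneg (by positivity), ← Real.rpow_mul two_pos.le]

theorem measurableSet_annulus (n : ℕ) (k : ℤ) : MeasurableSet (annulus n k) :=
  Metric.isOpen_ball.measurableSet.diff Metric.isOpen_ball.measurableSet

theorem volume_annulus_le (n : ℕ) (k : ℤ) :
    volume (annulus n k) ≤ ENNReal.ofReal (dyadicVol n k) :=
  (measure_mono sdiff_subset).trans_eq (volume_dyadic_ball n 0 k)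

theorem mem_annulus {n : ℕ} {k : ℤ} {x : Euc n} :
    x ∈ annulus n k ↔ ‖x‖ < 2 ^ k ∧ 2 ^ (k - 1) ≤ ‖x‖ := by
  simp [annulus]

theorem two_zpow_le_dist {n : ℕ} {j k : ℤ} (hjk : k + 2 ≤ j) {x y : Euc n}
    (hx : x ∈ annulus n j) (hy : y ∈ annulus n k) : (2 : ℝ) ^ (j - 2) ≤ dist x y := by
  have hx := (mem_annulus.1 hx).2
  have hy := (mem_annulus.1 hy).1
  have h1 : (2 : ℝ) ^ k ≤ 2 ^ (j - 2) := zpow_le_zpow_right₀ one_le_two (by omega)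
  have h2 : (2 : ℝ) ^ (j - 1) = 2 * 2 ^ (j - 2) := by
    rw [show j - 1 = 1 + (j - 2) by ring, zpow_add₀ two_ne_zero, zpow_one]
  have h3 := norm_sub_norm_le x y
  rw [dist_eq_norm]
  linarith

theorem maximalFn_indicator_le_of_far {n : ℕ} {j k : ℤ} (hjk : k + 2 ≤ j ∨ j + 2 ≤ k)
    {E : Set (Euc n)} (hE : MeasurableSet E) (hEk : E ⊆ annulus n k) {x : Euc n}
    (hx : x ∈ annulus n j) :
    maximalFn (E.indicator 1) x ≤ (ENNReal.ofReal (dyadicVol n (max j k - 3)))⁻¹ * volume E := by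
  refine maximalFn_le fun c ρ hρ hxc => ?_
  rw [setLIntegral_indicator_one hE]
  rcases (E ∩ Metric.ball c ρ).eq_empty_or_nonempty with he | ⟨y, hyE, hyc⟩
  · simp [he]
  have hd : (2 : ℝ) ^ (max j k - 2) ≤ dist x y := by
    rcases hjk with h | h
    · rw [max_eq_left (by omega)]
      exact two_zpow_le_dist h hx (hEk hyE)
    · rw [max_eq_right (by omega), dist_comm]
      exact two_zpow_le_dist h (hEk hyE) hx
  have h2 : (2 : ℝ) ^ (max j k - 2) = 2 * 2 ^ (max j k - 3) := by
    rw [show max j k - 2 = 1 + (max j k - 3) by ring, zpow_add₀ two_ne_zero, zpow_one]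
  have h3 := dist_triangle_right x y c
  rw [Metric.mem_ball] at hxc hyc
  rw [← volume_dyadic_ball n c]
  refine mul_le_mul' (ENNReal.inv_le_inv.2 (measure_mono (Metric.ball_subset_ball ?_)))
    (measure_mono inter_subset_left)
  linarith

/-- The constant in the bound of the integral over a set by the Lorentz quasinorm. -/
def lorentzIntegralConst (R Q : ℝ) : ℝ≥0∞ :=
  2 * (powNorm R Q 0)⁻¹ * ∑' i : ℕ, (2 : ℝ≥0∞) ^ (-((1 - 1 / R) * i))

theorem lorentzIntegralConst_ne_top {R Q : ℝ} (hQ : 0 < Q) (hR : 0 < 1 - 1 / R) :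
    lorentzIntegralConst R Q ≠ ∞ :=
  ENNReal.mul_ne_top (ENNReal.mul_ne_top ofNat_ne_top
    (ENNReal.inv_ne_top.2 (powNorm_zero_ne_zero hQ))) (tsum_two_rpow_neg_ne_top hR)

theorem setLIntegral_le_lorentzNorm {n : ℕ} {R Q : ℝ} (hR : 0 < R) (hQ : 0 < Q)
    {f : Euc n → ℝ≥0∞} (hf : Measurable f) {A : Set (Euc n)} {v : ℝ} (hv : 0 < v)
    (hA : volume A ≤ ENNReal.ofReal v) :
    ∫⁻ x in A, f x ∂volume ≤
      lorentzIntegralConst R Q * ENNReal.ofReal (v ^ (1 - 1 / R)) * lorentzNorm R Q f := by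
  refine (setLIntegral_le_tsum_rearrangement hf hA).trans ?_
  have : lorentzIntegralConst R Q * ENNReal.ofReal (v ^ (1 - 1 / R)) * lorentzNorm R Q f =
      ∑' i : ℕ, 2 * (powNorm R Q 0)⁻¹ * lorentzNorm R Q f *
        (ENNReal.ofReal (v ^ (1 - 1 / R)) * (2 : ℝ≥0∞) ^ (-((1 - 1 / R) * i))) := by
    rw [ENNReal.tsum_mul_left, ENNReal.tsum_mul_left, lorentzIntegralConst]
    ring
  rw [this]
  refine ENNReal.tsum_le_tsum fun i => ?_
  have hvi : 0 < v / 2 ^ i := by positivity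
  rw [← ofReal_div_two_pow_rpow hv.le, sub_eq_add_neg, Real.rpow_add hvi, Real.rpow_one,
    ENNReal.ofReal_mul hvi.le]
  refine (mul_le_mul' le_rfl (mul_le_mul' le_rfl
    (rearrangement_le_lorentzNorm hR hQ f hvi))).trans_eq ?_
  ring

/-- The exponent of the decay of the interaction between the annuli `C_j` and `C_k`. -/
def annulusExponent (n : ℕ) (β δ : ℝ) (k j : ℤ) : ℝ :=
  n * (k * (δ - β) - (max j k : ℤ) * δ + j * β)

/-- The constant in `exists_annulus_majorant`. -/
def annulusConst (n : ℕ) (R Q δ : ℝ) : ℝ≥0∞ :=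
  2 ^ (n * δ) * nearConst n R δ +
    2 ^ (n * (3 * δ)) * (powNorm R Q (δ - 1) * lorentzIntegralConst R Q)

theorem annulusConst_ne_top (n : ℕ) {R Q δ : ℝ} (hQ : 0 < Q) (hR : 0 < 1 - 1 / R)
    (hδ : 1 - 1 / R < δ) : annulusConst n R Q δ ≠ ∞ :=
  ENNReal.add_ne_top.2 ⟨ENNReal.mul_ne_top (two_rpow_ne_top _) (nearConst_ne_top n hR hδ),
    ENNReal.mul_ne_top (two_rpow_ne_top _) (ENNReal.mul_ne_top (powNorm_ne_top hQ (by linarith))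
      (lorentzIntegralConst_ne_top hQ hR))⟩

theorem exists_annulus_majorant_near {n : ℕ} (hn : 0 < n) {R Q δ : ℝ} (hQ : 1 ≤ Q)
    (hR1 : 0 < 1 - 1 / R) (hδ : 1 - 1 / R < δ) {f : Euc n → ℝ≥0∞}
    (hf : Measurable f) {j k : ℤ} (hjk : ¬ (k + 2 ≤ j ∨ j + 2 ≤ k)) :
    ∃ θ : ℝ → ℝ≥0∞, Measurable θ ∧
      (∀ (t : ℝ) (E : Set (Euc n)), 0 < t → MeasurableSet E → E ⊆ annulus n k →
        ENNReal.ofReal t < volume E →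
        ∫⁻ x, (annulus n j).indicator f x * maximalFn (E.indicator 1) x ^ δ ∂volume ≤
          volume E * θ t) ∧
      halfLineNorm R Q θ ≤ annulusConst n R Q δ * 2 ^ annulusExponent n (1 - 1 / R) δ k j *
        lorentzNorm R Q ((annulus n j).indicator f) := by
  refine ⟨_, measurable_nearFn δ ((annulus n j).indicator f), fun t E ht hE hEk htE => ?_,
    (halfLineNorm_nearFn_le hQ δ _).trans ?_⟩
  · exact lintegral_mul_maximalFn_rpow_le_nearFn hn (hf.indicator (measurableSet_annulus n j)) hE
      (zero_le.trans_lt htE).ne'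
      (ne_top_of_le_ne_top ofReal_ne_top ((measure_mono hEk).trans (volume_annulus_le n k)))
      (by linarith) htE.le
  · gcongr
    set β := 1 - 1 / R
    have he : -(n * δ) ≤ annulusExponent n β δ k j := by
      have : -δ ≤ (k * (δ - β) - (max j k : ℤ) * δ + j * β) := by
        obtain h | h | h : j = k ∨ j = k + 1 ∨ k = j + 1 := by omega
        · subst h; simp; nlinarith
        · subst h; rw [max_eq_left (by omega)]; push_cast; nlinarith
        · subst h; rw [max_eq_right (by omega)]; push_cast; nlinarith
      rw [annulusExponent, ← mul_neg]
      gcongr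
    calc nearConst n R δ = nearConst n R δ * (2 ^ (n * δ) * 2 ^ (-(n * δ))) := by
          rw [← two_rpow_add, add_neg_cancel, ENNReal.rpow_zero, mul_one]
      _ = 2 ^ (n * δ) * nearConst n R δ * 2 ^ (-(n * δ)) := by ring
      _ ≤ _ := mul_le_mul' le_self_add (ENNReal.rpow_le_rpow_of_exponent_le one_le_two he)

theorem exists_annulus_majorant_far {n : ℕ} {R Q δ : ℝ} (hR : 0 < R) (hQ : 1 ≤ Q)
    (hR1 : 0 < 1 - 1 / R) (hδ : 1 - 1 / R < δ) (hδ1 : δ < 1) {f : Euc n → ℝ≥0∞}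
    (hf : Measurable f) {j k : ℤ} (hjk : k + 2 ≤ j ∨ j + 2 ≤ k) :
    ∃ θ : ℝ → ℝ≥0∞, Measurable θ ∧
      (∀ (t : ℝ) (E : Set (Euc n)), 0 < t → MeasurableSet E → E ⊆ annulus n k →
        ENNReal.ofReal t < volume E →
        ∫⁻ x, (annulus n j).indicator f x * maximalFn (E.indicator 1) x ^ δ ∂volume ≤
          volume E * θ t) ∧
      halfLineNorm R Q θ ≤ annulusConst n R Q δ * 2 ^ annulusExponent n (1 - 1 / R) δ k j *
        lorentzNorm R Q ((annulus n j).indicator f) := by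
  have hQ0 : 0 < Q := by linarith
  have hδ0 : 0 < δ := by linarith
  set N := max j k with hN
  set F := (annulus n j).indicator f with hF
  have hFm : Measurable F := hf.indicator (measurableSet_annulus n j)
  set W := ENNReal.ofReal (dyadicVol n (N - 3) ^ (-δ)) with hW
  have hmeas := measurable_pow_indicator (δ - 1) (dyadicVol n k)
  refine ⟨fun t => (W * ∫⁻ x in annulus n j, F x ∂volume) *
    (Iio (dyadicVol n k)).indicator (fun t => ENNReal.ofReal (t ^ (δ - 1))) t,
    hmeas.const_mul _, fun t E ht hE hEk htE => ?_, ?_⟩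
  · have hEv := (measure_mono hEk).trans (volume_annulus_le n k)
    have hE0 : volume E ≠ 0 := (zero_le.trans_lt htE).ne'
    have hEfin : volume E ≠ ∞ := ne_top_of_le_ne_top ofReal_ne_top hEv
    have htk : t < dyadicVol n k :=
      (ENNReal.ofReal_lt_ofReal_iff (dyadicVol_pos n k)).1 (htE.trans_le hEv)
    have hpt : ∀ x, F x * maximalFn (E.indicator 1) x ^ δ ≤ F x * (W * volume E ^ δ) := by
      intro x
      by_cases hx : x ∈ annulus n j
      · refine mul_le_mul' le_rfl ?_
        have h := ENNReal.rpow_le_rpow (maximalFn_indicator_le_of_far hjk hE hEk hx) hδ0.le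
        rwa [ENNReal.mul_rpow_of_nonneg _ _ hδ0.le, ← ENNReal.rpow_neg_one, ← ENNReal.rpow_mul,
          neg_one_mul, ENNReal.ofReal_rpow_of_pos (dyadicVol_pos n _)] at h
      · rw [hF, indicator_of_notMem hx, zero_mul, zero_mul]
    have hvol : volume E ^ δ ≤ volume E * ENNReal.ofReal (t ^ (δ - 1)) := by
      have h1 : volume E ^ δ = volume E * volume E ^ (δ - 1) := by
        conv_rhs => rw [← ENNReal.rpow_one (volume E), ← ENNReal.rpow_mul, one_mul,
          ← ENNReal.rpow_add _ _ hE0 hEfin, add_sub_cancel]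
      rw [h1, ← ENNReal.ofReal_rpow_of_pos ht]
      refine mul_le_mul' le_rfl ?_
      rw [← neg_sub 1 δ, ENNReal.rpow_neg, ENNReal.rpow_neg, ENNReal.inv_le_inv]
      exact ENNReal.rpow_le_rpow htE.le (by linarith)
    have hFint : ∫⁻ x, F x ∂volume = ∫⁻ x in annulus n j, F x ∂volume := by
      rw [hF, setLIntegral_indicator (measurableSet_annulus n j), inter_self,
        lintegral_indicator (measurableSet_annulus n j)]
    beta_reduce
    rw [indicator_of_mem (show t ∈ Iio (dyadicVol n k) from htk), ← hFint]
    calc _ ≤ ∫⁻ x, F x * (W * volume E ^ δ) ∂volume := lintegral_mono hpt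
      _ = (∫⁻ x, F x ∂volume) * (W * volume E ^ δ) := lintegral_mul_const _ hFm
      _ ≤ (∫⁻ x, F x ∂volume) * (W * (volume E * ENNReal.ofReal (t ^ (δ - 1)))) := by gcongr
      _ = _ := by ring
  · rw [halfLineNorm_const_mul hQ0 hmeas, halfLineNorm_pow_indicator hQ0 _ (dyadicVol_pos n k)]
    set β := 1 - 1 / R with hβ
    have hint := setLIntegral_le_lorentzNorm hR hQ0 hFm (dyadicVol_pos n j) (volume_annulus_le n j)
    rw [← hβ] at hint
    have hexp : W * ENNReal.ofReal (dyadicVol n j ^ β) *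
        ENNReal.ofReal (dyadicVol n k ^ (δ - 1 + 1 / R)) =
        2 ^ (n * (3 * δ)) * 2 ^ annulusExponent n β δ k j := by
      have hκ := toReal_volume_ball_pos n
      rw [hW, ← ENNReal.ofReal_mul (Real.rpow_nonneg (dyadicVol_pos _ _).le _),
        ← ENNReal.ofReal_mul (mul_nonneg (Real.rpow_nonneg (dyadicVol_pos _ _).le _)
          (Real.rpow_nonneg (dyadicVol_pos _ _).le _)), ← two_rpow_add, ← ofReal_two_rpow,
        dyadicVol_rpow, dyadicVol_rpow, dyadicVol_rpow]
      congr 1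
      set κ := (volume (Metric.ball (0 : Euc n) 1)).toReal
      have h1 : κ ^ (-δ) * κ ^ β * κ ^ (δ - 1 + 1 / R) = 1 := by
        rw [← Real.rpow_add hκ, ← Real.rpow_add hκ, hβ]
        convert Real.rpow_zero κ using 2
        ring
      have h2 : (2 : ℝ) ^ (((N - 3 : ℤ) : ℝ) * n * -δ) * 2 ^ ((j : ℝ) * n * β) *
          2 ^ ((k : ℝ) * n * (δ - 1 + 1 / R)) =
          2 ^ (n * (3 * δ) + annulusExponent n β δ k j) := by
        rw [← Real.rpow_add two_pos, ← Real.rpow_add two_pos, annulusExponent, ← hN, hβ]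
        congr 1
        push_cast
        ring
      rw [← h2]
      linear_combination (2 : ℝ) ^ (((N - 3 : ℤ) : ℝ) * n * -δ) * 2 ^ ((j : ℝ) * n * β) *
        2 ^ ((k : ℝ) * n * (δ - 1 + 1 / R)) * h1
    calc _ ≤ W * (lorentzIntegralConst R Q * ENNReal.ofReal (dyadicVol n j ^ β) *
            lorentzNorm R Q F) *
          (ENNReal.ofReal (dyadicVol n k ^ (δ - 1 + 1 / R)) * powNorm R Q (δ - 1)) := by
          gcongr
      _ = (W * ENNReal.ofReal (dyadicVol n j ^ β) *
            ENNReal.ofReal (dyadicVol n k ^ (δ - 1 + 1 / R))) *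
          (powNorm R Q (δ - 1) * lorentzIntegralConst R Q * lorentzNorm R Q F) := by ring
      _ = 2 ^ (n * (3 * δ)) * (powNorm R Q (δ - 1) * lorentzIntegralConst R Q) *
          2 ^ annulusExponent n β δ k j * lorentzNorm R Q F := by rw [hexp]; ring
      _ ≤ _ := mul_le_mul' (mul_le_mul' le_add_self le_rfl) le_rfl

theorem exists_mem_annulus {n : ℕ} {x : Euc n} (hx : x ≠ 0) : ∃ k : ℤ, x ∈ annulus n k := by
  obtain ⟨k, hk1, hk2⟩ := exists_mem_Ico_zpow (norm_pos_iff.2 hx) one_lt_two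
  exact ⟨k + 1, mem_annulus.2 ⟨hk2, by simpa using hk1⟩⟩

/-- If `g` is controlled by `f` in `L¹` with weights `(Mχ_E)^δ`, then the Lorentz quasinorms of
`g` on the annuli are controlled by those of `f`, with geometric decay off the diagonal. -/
theorem lorentzNorm_annulus_le {n : ℕ} (hn : 0 < n) {R Q δ : ℝ} (hR : 0 < R) (hQ : 1 ≤ Q)
    (hR1 : 0 < 1 - 1 / R) (hδ : 1 - 1 / R < δ) (hδ1 : δ < 1) {f g : Euc n → ℝ≥0∞}
    (hf : Measurable f) (hg : Measurable g) {C : ℝ≥0∞}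
    (hfg : ∀ E : Set (Euc n), MeasurableSet E → volume E ≠ 0 →
      ∫⁻ x, g x * maximalFn (E.indicator 1) x ^ δ ∂volume ≤
        C * ∫⁻ x, f x * maximalFn (E.indicator 1) x ^ δ ∂volume) (k : ℤ) :
    lorentzNorm R Q ((annulus n k).indicator g) ≤
      C * ∑' j : ℤ, annulusConst n R Q δ * 2 ^ annulusExponent n (1 - 1 / R) δ k j *
        lorentzNorm R Q ((annulus n j).indicator f) := by
  have hQ0 : 0 < Q := by linarith
  have hδ0 : 0 < δ := by linarith
  have hex : ∀ j : ℤ, ∃ θ : ℝ → ℝ≥0∞, Measurable θ ∧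
      (∀ (t : ℝ) (E : Set (Euc n)), 0 < t → MeasurableSet E → E ⊆ annulus n k →
        ENNReal.ofReal t < volume E →
        ∫⁻ x, (annulus n j).indicator f x * maximalFn (E.indicator 1) x ^ δ ∂volume ≤
          volume E * θ t) ∧
      halfLineNorm R Q θ ≤ annulusConst n R Q δ * 2 ^ annulusExponent n (1 - 1 / R) δ k j *
        lorentzNorm R Q ((annulus n j).indicator f) := fun j => by
    by_cases hjk : k + 2 ≤ j ∨ j + 2 ≤ k
    · exact exists_annulus_majorant_far hR hQ hR1 hδ hδ1 hf hjk
    · exact exists_annulus_majorant_near hn hQ hR1 hδ hf hjk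
  choose θ hθm hθ hθn using hex
  have hkey : ∀ t : ℝ, 0 < t →
      rearrangement ((annulus n k).indicator g) t ≤ C * ∑' j, θ j t := by
    intro t ht
    refine le_of_forall_lt fun l hl => ?_
    obtain ⟨l', hll', hl'⟩ := exists_between hl
    refine hll'.trans_le ?_
    set E := {x | l' < (annulus n k).indicator g x} with hEdef
    have hE : MeasurableSet E :=
      measurableSet_lt measurable_const (hg.indicator (measurableSet_annulus n k))
    have htE : ENNReal.ofReal t < volume E := lt_volume_of_lt_rearrangement hl'
    have hEk : E ⊆ annulus n k := fun x hx => by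
      by_contra hxk
      have hx' : l' < (annulus n k).indicator g x := hx
      rw [indicator_of_notMem hxk] at hx'
      exact ENNReal.not_lt_zero hx'
    have hE0 : volume E ≠ 0 := (zero_le.trans_lt htE).ne'
    have hEfin : volume E ≠ ∞ :=
      ne_top_of_le_ne_top ofReal_ne_top ((measure_mono hEk).trans (volume_annulus_le n k))
    have : Nontrivial (Euc n) := by
      have : Nonempty (Fin n) := ⟨⟨0, hn⟩⟩
      infer_instance
    have hM : Measurable fun x => maximalFn (E.indicator 1) x ^ δ :=
      (measurable_maximalFn _).pow_const δ
    have hjm : ∀ j, AEMeasurable (fun x => (annulus n j).indicator f x *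
        maximalFn (E.indicator 1) x ^ δ) volume := fun j =>
      ((hf.indicator (measurableSet_annulus n j)).mul hM).aemeasurable
    rw [← ENNReal.mul_le_mul_iff_right hE0 hEfin]
    calc volume E * l' = ∫⁻ x in E, l' ∂volume := by rw [setLIntegral_const, mul_comm]
      _ ≤ ∫⁻ x in E, g x * maximalFn (E.indicator 1) x ^ δ ∂volume := by
          refine lintegral_mono_ae ((ae_restrict_iff' hE).2 ?_)
          filter_upwards [one_le_maximalFn_indicator_ae hE] with x hx hxE
          have hx' : l' < (annulus n k).indicator g x := hxE
          rw [indicator_of_mem (hEk hxE)] at hx'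
          exact hx'.le.trans (le_mul_of_one_le_right' (ENNReal.one_le_rpow (hx hxE) hδ0))
      _ ≤ ∫⁻ x, g x * maximalFn (E.indicator 1) x ^ δ ∂volume := setLIntegral_le_lintegral _ _
      _ ≤ C * ∫⁻ x, f x * maximalFn (E.indicator 1) x ^ δ ∂volume := hfg E hE hE0
      _ ≤ C * ∫⁻ x, ∑' j : ℤ,
          (annulus n j).indicator f x * maximalFn (E.indicator 1) x ^ δ ∂volume := by
          gcongr 1
          refine lintegral_mono_ae ?_
          filter_upwards [compl_mem_ae_iff.2 (measure_singleton (0 : Euc n))] with x hx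
          obtain ⟨j, hj⟩ := exists_mem_annulus hx
          refine le_trans (le_of_eq ?_) (ENNReal.le_tsum j)
          rw [indicator_of_mem hj]
      _ = C * ∑' j : ℤ, ∫⁻ x,
          (annulus n j).indicator f x * maximalFn (E.indicator 1) x ^ δ ∂volume := by
          rw [lintegral_tsum hjm]
      _ ≤ C * ∑' j : ℤ, volume E * θ j t := by
          gcongr with j
          exact hθ j t E ht hE hEk htE
      _ = _ := by rw [ENNReal.tsum_mul_left]; ring
  calc lorentzNorm R Q ((annulus n k).indicator g)
      ≤ halfLineNorm R Q (fun t => C * ∑' j, θ j t) := halfLineNorm_mono hQ0 hkey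
    _ = C * halfLineNorm R Q (fun t => ∑' j, θ j t) :=
        halfLineNorm_const_mul hQ0 (Measurable.tsum hθm) C
    _ ≤ C * ∑' j, halfLineNorm R Q (θ j) := by
        gcongr 1
        exact halfLineNorm_tsum_le hQ hθm
    _ ≤ _ := by
        gcongr with j
        exact hθn j

theorem rearrangement_rpow {n : ℕ} (f : Euc n → ℝ≥0∞) {s : ℝ} (hs : 0 < s) (t : ℝ) :
    rearrangement (fun x => f x ^ s) t = rearrangement f t ^ s := by
  refine le_antisymm ?_ (le_iInf₂ fun l hl => ?_)
  · rw [← ENNReal.rpow_inv_le_iff hs]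
    refine le_iInf₂ fun l hl => ?_
    rw [ENNReal.rpow_inv_le_iff hs]
    refine iInf₂_le (l ^ s) ?_
    simpa only [ENNReal.rpow_lt_rpow_iff hs] using hl
  · rw [← ENNReal.le_rpow_inv_iff hs]
    refine iInf₂_le (l ^ s⁻¹) ?_
    simpa only [ENNReal.rpow_inv_lt_iff hs] using hl

theorem lorentzNorm_rpow {n : ℕ} (r q : ℝ) {s : ℝ} (hs : 0 < s) (f : Euc n → ℝ≥0∞) :
    lorentzNorm r q f ^ s = lorentzNorm (r / s) (q / s) (fun x => f x ^ s) := by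
  rw [lorentzNorm, lorentzNorm, ← ENNReal.rpow_mul, one_div_div, one_div_div,
    one_div_mul_eq_div]
  congr 1
  refine setLIntegral_congr_fun measurableSet_Ioi fun t (ht : 0 < t) => ?_
  have h : ENNReal.ofReal (t ^ (s / r)) = ENNReal.ofReal (t ^ (1 / r)) ^ s := by
    rw [ENNReal.ofReal_rpow_of_pos (by positivity), ← Real.rpow_mul ht.le, one_div_mul_eq_div]
  rw [rearrangement_rpow f hs, h, ← ENNReal.mul_rpow_of_nonneg _ _ hs.le, ← ENNReal.rpow_mul,
    mul_div_cancel₀ _ hs.ne']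

theorem herzNorm_lorentzNorm_rpow {n : ℕ} (r q α p : ℝ) {s : ℝ} (hs : 0 < s) (hp : 0 < p)
    (f : Euc n → ℝ≥0∞) :
    herzNorm (lorentzNorm r q) α p f ^ s =
      (∑' k : ℤ, (2 ^ (k * (α * s)) *
        lorentzNorm (r / s) (q / s) ((annulus n k).indicator fun x => f x ^ s)) ^ (p / s)) ^
        (1 / (p / s)) := by
  rw [herzNorm, ← ENNReal.rpow_mul, one_div_div, one_div_mul_eq_div]
  congr 1
  refine tsum_congr fun k => ?_
  have h : ((annulus n k).indicator fun x => f x ^ s) =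
      fun x => (annulus n k).indicator f x ^ s := by
    ext x
    by_cases hx : x ∈ annulus n k
    · simp [hx]
    · simp [hx, hs]
  rw [h, ← lorentzNorm_rpow r q hs, ENNReal.mul_rpow_of_nonneg _ _ (div_pos hp hs).le,
    ← ENNReal.rpow_mul, ← ENNReal.rpow_mul, mul_div_cancel₀ _ hs.ne']
  congr 2
  field_simp

/-- Young's convolution inequality `ℓ¹ * ℓ^p ⊆ ℓ^p` on `ℤ`. -/
theorem tsum_rpow_le_of_le_convolution {p : ℝ} (hp : 1 ≤ p) {a x y : ℤ → ℝ≥0∞}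
    (h : ∀ k, y k ≤ ∑' i, a i * x (k + i)) :
    (∑' k, y k ^ p) ^ (1 / p) ≤ (∑' i, a i) * (∑' k, x k ^ p) ^ (1 / p) := by
  have hp0 : 0 < p := by linarith
  calc (∑' k, y k ^ p) ^ (1 / p) ≤ (∑' k, (∑' i, a i * x (k + i)) ^ p) ^ (1 / p) := by
        gcongr with k
        exact h k
    _ ≤ ∑' i, (∑' k, (a i * x (k + i)) ^ p) ^ (1 / p) := by
        simpa only [lintegral_count] using lintegral_Lp_tsum_le (μ := Measure.count)
          (f := fun i k => a i * x (k + i)) (fun i => (measurable_of_countable _).aemeasurable) hp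
    _ = ∑' i, a i * (∑' k, x k ^ p) ^ (1 / p) := by
        refine tsum_congr fun i => ?_
        simp_rw [ENNReal.mul_rpow_of_nonneg _ _ hp0.le]
        rw [ENNReal.tsum_mul_left, show ∑' k, x (k + i) ^ p = ∑' k, x k ^ p from
            (Equiv.addRight i).tsum_eq (fun k => x k ^ p),
          ENNReal.mul_rpow_of_nonneg _ _ (by positivity), ← ENNReal.rpow_mul,
          mul_one_div_cancel hp0.ne', ENNReal.rpow_one]
    _ = _ := ENNReal.tsum_mul_right

theorem tsum_two_rpow_neg_abs_ne_top {ε : ℝ} (hε : 0 < ε) :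
    ∑' i : ℤ, (2 : ℝ≥0∞) ^ (-(ε * |(i : ℝ)|)) ≠ ∞ := by
  rw [tsum_of_nat_of_neg_add_one ENNReal.summable ENNReal.summable]
  refine ENNReal.add_ne_top.2 ⟨?_, ne_top_of_le_ne_top (tsum_two_rpow_neg_ne_top hε)
    (ENNReal.tsum_le_tsum fun m => ENNReal.rpow_le_rpow_of_exponent_le one_le_two ?_)⟩
  · simpa using tsum_two_rpow_neg_ne_top hε
  · have h : |((-((m : ℤ) + 1) : ℤ) : ℝ)| = m + 1 := by
      push_cast
      rw [abs_neg, abs_of_nonneg (by positivity)]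
    rw [h]
    nlinarith

theorem annulusExponent_add_le {n : ℕ} {β δ A ε : ℝ} (h1 : ε ≤ n * (δ - β) + A)
    (h2 : ε ≤ n * β - A) (k i : ℤ) :
    k * A + annulusExponent n β δ k (k + i) ≤ -(ε * |(i : ℝ)|) + (k + i : ℤ) * A := by
  rw [annulusExponent]
  rcases le_total 0 i with hi | hi
  · have hi' : (0 : ℝ) ≤ i := by exact_mod_cast hi
    rw [max_eq_left (by omega), abs_of_nonneg hi']
    push_cast
    nlinarith [mul_le_mul_of_nonneg_right h1 hi']
  · have hi' : (i : ℝ) ≤ 0 := by exact_mod_cast hi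
    rw [max_eq_right (by omega), abs_of_nonpos hi']
    push_cast
    nlinarith [mul_le_mul_of_nonneg_right h2 (neg_nonneg.2 hi')]

theorem herz_lorentzNorm_le {n : ℕ} (hn : 0 < n) {P R Q A δ ε : ℝ} (hP : 1 ≤ P) (hR : 0 < R)
    (hQ : 1 ≤ Q) (hR1 : 0 < 1 - 1 / R) (hδ : 1 - 1 / R < δ) (hδ1 : δ < 1)
    (h1 : ε ≤ n * (δ - (1 - 1 / R)) + A) (h2 : ε ≤ n * (1 - 1 / R) - A)
    {f g : Euc n → ℝ≥0∞} (hf : Measurable f) (hg : Measurable g) {C : ℝ≥0∞}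
    (hfg : ∀ E : Set (Euc n), MeasurableSet E → volume E ≠ 0 →
      ∫⁻ x, g x * maximalFn (E.indicator 1) x ^ δ ∂volume ≤
        C * ∫⁻ x, f x * maximalFn (E.indicator 1) x ^ δ ∂volume) :
    (∑' k : ℤ, (2 ^ (k * A) * lorentzNorm R Q ((annulus n k).indicator g)) ^ P) ^ (1 / P) ≤
      C * annulusConst n R Q δ * (∑' i : ℤ, (2 : ℝ≥0∞) ^ (-(ε * |(i : ℝ)|))) *
      (∑' k : ℤ, (2 ^ (k * A) * lorentzNorm R Q ((annulus n k).indicator f)) ^ P) ^ (1 / P) := by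
  rw [← ENNReal.tsum_mul_left]
  refine tsum_rpow_le_of_le_convolution hP fun k => ?_
  set β := 1 - 1 / R
  set D := annulusConst n R Q δ
  set X : ℤ → ℝ≥0∞ := fun j => lorentzNorm R Q ((annulus n j).indicator f)
  calc 2 ^ (k * A) * lorentzNorm R Q ((annulus n k).indicator g)
      ≤ 2 ^ (k * A) * (C * ∑' j : ℤ, D * 2 ^ annulusExponent n β δ k j * X j) := by
        gcongr
        exact lorentzNorm_annulus_le hn hR hQ hR1 hδ hδ1 hf hg hfg k
    _ = 2 ^ (k * A) * (C * ∑' i : ℤ, D * 2 ^ annulusExponent n β δ k (k + i) * X (k + i)) := by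
        rw [← (Equiv.addLeft k).tsum_eq]
        rfl
    _ = ∑' i : ℤ, C * D * (2 ^ (k * A + annulusExponent n β δ k (k + i))) * X (k + i) := by
        rw [← ENNReal.tsum_mul_left, ← ENNReal.tsum_mul_left]
        refine tsum_congr fun i => ?_
        rw [two_rpow_add]
        ring
    _ ≤ ∑' i : ℤ, C * D * (2 ^ (-(ε * |(i : ℝ)|) + (k + i : ℤ) * A)) * X (k + i) := by
        refine ENNReal.tsum_le_tsum fun i => ?_
        gcongr C * D * ?_ * _
        exact ENNReal.rpow_le_rpow_of_exponent_le one_le_two (annulusExponent_add_le h1 h2 k i)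
    _ = _ := by
        refine tsum_congr fun i => ?_
        rw [two_rpow_add]
        ring

/-- The weighted bound for `T`, raised to the power `s`. -/
theorem lintegral_rpow_mul_le_of_wLpNorm_le {n : ℕ} {s : ℝ} (hs : 0 < s) {w : Euc n → ℝ≥0∞}
    {f g : Euc n → ℝ} {K : ℝ≥0∞} (hK : K ≠ 0)
    (h : wLpNorm s w f < ∞ → wLpNorm s w g ≤ K * wLpNorm s w f) :
    ∫⁻ x, (‖g x‖₊ : ℝ≥0∞) ^ s * w x ∂volume ≤
      K ^ s * ∫⁻ x, (‖f x‖₊ : ℝ≥0∞) ^ s * w x ∂volume := by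
  by_cases hf : ∫⁻ x, (‖f x‖₊ : ℝ≥0∞) ^ s * w x ∂volume = ∞
  · rw [hf, ENNReal.mul_top (ENNReal.rpow_pos_of_nonneg (pos_iff_ne_zero.2 hK) hs.le).ne']
    exact le_top
  · have h' := ENNReal.rpow_le_rpow
      (h (ENNReal.rpow_lt_top_of_nonneg (by positivity) hf)) hs.le
    rwa [ENNReal.mul_rpow_of_nonneg _ _ hs.le, wLpNorm, wLpNorm, ← ENNReal.rpow_mul,
      ← ENNReal.rpow_mul, one_div_mul_cancel hs.ne', ENNReal.rpow_one, ENNReal.rpow_one] at h'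

/-- extrapolation on Herz–Lorentz spaces. Let `0 < s < p < ∞`,
`s < r < ∞`, `s < q < ∞` with `−n/r < α < n(1/s − 1/r)`. If `T` satisfies
`‖Tf‖_{L^s_w} ≤ C([w]_{A₁})‖f‖_{L^s_w}` for all `w ∈ A₁`, then `T` is bounded on
`K̇^{α,p}_{r,q}(ℝⁿ)`. -/
theorem stmt18 {n : ℕ} (hn : 0 < n) (α p s r q : ℝ) (hs : 0 < s) (hsp : s < p)
    (hr : s < r) (hq : s < q)
    (hα : -((n : ℝ) / r) < α ∧ α < (n : ℝ) * (1 / s - 1 / r))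
    (T : (Euc n → ℝ) → Euc n → ℝ)
    (hTmeas : ∀ f : Euc n → ℝ, Measurable f → Measurable (T f))
    (hT : ∀ Λ : ℝ≥0∞, 1 ≤ Λ → Λ ≠ ∞ → ∃ CΛ : ℝ≥0∞, CΛ < ∞ ∧
      ∀ w : Euc n → ℝ≥0∞, IsA1 Λ w → ∀ f : Euc n → ℝ, Measurable f →
        wLpNorm s w f < ∞ → wLpNorm s w (T f) ≤ CΛ * wLpNorm s w f) :
    ∃ C' : ℝ≥0∞, 0 < C' ∧ C' < ∞ ∧
      ∀ f : Euc n → ℝ, Measurable f → herzR (lorentzNorm r q) α p f ≠ ∞ →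
        herzR (lorentzNorm r q) α p (T f) ≤ C' * herzR (lorentzNorm r q) α p f := by
  have hn' : (0 : ℝ) < n := by exact_mod_cast hn
  have hr0 : 0 < r := hs.trans hr
  have hR1 : 0 < 1 - 1 / (r / s) := by
    rw [one_div_div, sub_pos, div_lt_one hr0]
    exact hr
  set β := 1 - 1 / (r / s) with hβ
  have hβ1 : 1 - β = s / r := by rw [hβ, one_div_div]; ring
  have hA1 : -(n * (1 - β)) < α * s := by
    have := mul_lt_mul_of_pos_right hα.1 hs
    rw [hβ1]
    calc _ = -(n / r) * s := by ring
      _ < _ := this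
  have hA2 : α * s < n * β := by
    have := mul_lt_mul_of_pos_right hα.2 hs
    calc _ < n * (1 / s - 1 / r) * s := this
      _ = n * (1 - (1 - β)) := by rw [hβ1]; field_simp
      _ = _ := by ring
  obtain ⟨δ, hδ, hδ1⟩ : ∃ δ, max β (β - α * s / n) < δ ∧ δ < 1 := by
    refine exists_between (max_lt ?_ ?_)
    · have : 0 < 1 - β := hβ1 ▸ div_pos hs hr0
      linarith
    · rw [sub_lt_iff_lt_add, ← sub_lt_iff_lt_add', lt_div_iff₀ hn']
      linarith
  rw [max_lt_iff] at hδ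
  have hδA : -(α * s) < n * (δ - β) := by
    have := (div_lt_iff₀ hn').1 (show -(α * s) / n < δ - β by rw [neg_div]; linarith [hδ.2])
    linarith
  set ε := min (n * (δ - β) + α * s) (n * β - α * s) with hε
  have hε0 : 0 < ε := lt_min (by linarith) (by linarith)
  have hδ0 : 0 < δ := hR1.trans hδ.1
  set Λ := (1 + kolmogorovConst n δ) * ENNReal.ofReal (3 ^ n) ^ δ with hΛ
  have hΛ1 : 1 ≤ Λ := one_le_mul le_self_add (ENNReal.one_le_rpow (by
    rw [ENNReal.one_le_ofReal]
    exact one_le_pow₀ (by norm_num)) hδ0)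
  have hΛtop : Λ ≠ ∞ := ENNReal.mul_ne_top
    (ENNReal.add_ne_top.2 ⟨one_ne_top, kolmogorovConst_ne_top n hδ1⟩)
    (ENNReal.rpow_ne_top_of_nonneg hδ0.le ofReal_ne_top)
  obtain ⟨K, hK, hTK⟩ := hT Λ hΛ1 hΛtop
  set B := (K + 1) ^ s * annulusConst n (r / s) (q / s) δ *
    ∑' i : ℤ, (2 : ℝ≥0∞) ^ (-(ε * |(i : ℝ)|)) with hB
  have hBtop : B ≠ ∞ := ENNReal.mul_ne_top (ENNReal.mul_ne_top
    (ENNReal.rpow_ne_top_of_nonneg hs.le (ENNReal.add_ne_top.2 ⟨hK.ne, one_ne_top⟩))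
    (annulusConst_ne_top n (div_pos (hs.trans hq) hs) hR1 hδ.1))
    (tsum_two_rpow_neg_abs_ne_top hε0)
  refine ⟨B ^ s⁻¹ + 1, by simp, ENNReal.add_lt_top.2
    ⟨ENNReal.rpow_lt_top_of_nonneg (by positivity) hBtop, one_lt_top⟩, fun f hf _ => ?_⟩
  have hpow : herzR (lorentzNorm r q) α p (T f) ^ s ≤
      B * herzR (lorentzNorm r q) α p f ^ s := by
    rw [herzR, herzR, herzNorm_lorentzNorm_rpow r q α p hs (hs.trans hsp),
      herzNorm_lorentzNorm_rpow r q α p hs (hs.trans hsp)]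
    refine herz_lorentzNorm_le hn ((one_le_div hs).2 hsp.le) (div_pos hr0 hs)
      ((one_le_div hs).2 hq.le) hR1 hδ.1 hδ1 (min_le_left _ _) (min_le_right _ _)
      (hf.nnnorm.coe_nnreal_ennreal.pow_const s)
      ((hTmeas f hf).nnnorm.coe_nnreal_ennreal.pow_const s) fun E hE hE0 => ?_
    refine lintegral_rpow_mul_le_of_wLpNorm_le hs (by simp) fun hfin => ?_
    refine (hTK _ (isA1_maximalFn_indicator_rpow hn hE hE0 hδ0) f hf hfin).trans ?_
    gcongr
    exact le_self_add
  calc herzR (lorentzNorm r q) α p (T f)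
      ≤ (B * herzR (lorentzNorm r q) α p f ^ s) ^ s⁻¹ := (ENNReal.le_rpow_inv_iff hs).2 hpow
    _ = B ^ s⁻¹ * herzR (lorentzNorm r q) α p f := by
        rw [ENNReal.mul_rpow_of_nonneg _ _ (by positivity), ← ENNReal.rpow_mul,
          mul_inv_cancel₀ hs.ne', ENNReal.rpow_one]
    _ ≤ _ := by
        gcongr
        exact le_self_add
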